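/- Let q > p ≥ 2 and K > 0. There exists a constant C > 0, depending only on p, q and K, such that for every real Banach space B with modulus of uniform convexity η(ε) = K ε^p and every f ∈ ℓ^p(B), ∑_{x∈ℤ} V(x)^{p/q} ≤ C^p ‖f‖_{ℓ^p(B)}^p, where for each x ∈ ℤ, V(x) is the supremum, over all finite strictly increasing sequences t_0 < t_1 < … < t_m of positive integers, of ∑_{k<m} ‖(A_{t_{k+1}} f)(x) − (A_{t_k} f)(x)‖_B^q. -/

import Mathlib

open Finset ENNReal NNReal

/-- The shift ergodic averages on `ℤ`: `(A_n f)(x) = (1/n) ∑_{i<n} f (x + i)`. -/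
noncomputable def shiftAvg {B : Type*} [AddCommGroup B] [Module ℝ B]
    (n : ℕ) (f : ℤ → B) (x : ℤ) : B :=
  (n : ℝ)⁻¹ • ∑ i ∈ Finset.range n, f (x + (i : ℤ))

/-! ### Scalar inequalities -/

theorem add_rpow_le_two_rpow_mul {p a b : ℝ} (hp : 0 ≤ p) (ha : 0 ≤ a) (hb : 0 ≤ b) :
    (a + b) ^ p ≤ 2 ^ p * (a ^ p + b ^ p) := by
  have h : a + b ≤ 2 * max a b := by
    have := le_max_left a b
    have := le_max_right a b
    linarith
  calc (a + b) ^ p ≤ (2 * max a b) ^ p := Real.rpow_le_rpow (by positivity) h hp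
    _ = 2 ^ p * (max a b) ^ p := Real.mul_rpow (by norm_num) (le_max_of_le_left ha)
    _ ≤ 2 ^ p * (a ^ p + b ^ p) := by
      have hap := Real.rpow_nonneg ha p
      have hbp := Real.rpow_nonneg hb p
      gcongr
      rcases max_cases a b with h | h <;> rw [h.1] <;> linarith

theorem clarkson_scalar {p a b : ℝ} (hp : 2 ≤ p) (hb : 0 ≤ b) (hab : b ≤ a) :
    ((a + b) / 2) ^ p + ((a - b) / 2) ^ p ≤ (a ^ p + b ^ p) / 2 := by
  have ha : 0 ≤ a := hb.trans hab
  have key : ∀ u : ℝ, 0 ≤ u → u ^ p = (u ^ 2) ^ (p / 2) := by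
    intro u hu
    rw [← Real.rpow_natCast, ← Real.rpow_mul hu]
    congr 1
    push_cast
    ring
  rw [key _ (by positivity : 0 ≤ (a + b) / 2), key _ (by linarith : 0 ≤ (a - b) / 2),
    key a ha, key b hb]
  have h1 := Real.add_rpow_le_rpow_add (p := p / 2) (sq_nonneg ((a + b) / 2))
    (sq_nonneg ((a - b) / 2)) (by linarith)
  have hconv := convexOn_rpow (p := p / 2) (by linarith)
  have h2 := hconv.2 (Set.mem_Ici.2 (sq_nonneg a)) (Set.mem_Ici.2 (sq_nonneg b))
    (by norm_num : (0 : ℝ) ≤ 1 / 2) (by norm_num : (0 : ℝ) ≤ 1 / 2) (by norm_num)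
  simp only [smul_eq_mul] at h2
  have h3 : ((a + b) / 2) ^ 2 + ((a - b) / 2) ^ 2 = 1 / 2 * a ^ 2 + 1 / 2 * b ^ 2 := by ring
  rw [h3] at h1
  linarith

theorem rpow_tangent_le {p s t : ℝ} (hp : 1 ≤ p) (hs : 0 ≤ s) (ht : 0 ≤ t) :
    s ^ p + p * s ^ (p - 1) * (t - s) ≤ t ^ p := by
  rcases hs.eq_or_lt with rfl | hs
  · rcases hp.eq_or_lt with rfl | hp
    · simp
    · rw [Real.zero_rpow (by linarith), Real.zero_rpow (by linarith)]
      simpa using Real.rpow_nonneg ht p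
  · have h := one_add_mul_self_le_rpow_one_add (s := (t - s) / s)
      (by rw [le_div_iff₀ hs]; linarith) hp
    have h1 : 1 + (t - s) / s = t / s := by field_simp; ring
    rw [h1, Real.div_rpow ht hs.le, le_div_iff₀ (by positivity)] at h
    rw [Real.rpow_sub_one hs.ne']
    refine le_of_eq_of_le ?_ h
    field_simp

theorem rpow_sub_le {p a h : ℝ} (hp : 1 ≤ p) (h0 : 0 ≤ h) (ha : h ≤ a) :
    (a - h) ^ p ≤ a ^ p - a ^ (p - 1) * h := by
  rcases (h0.trans ha).eq_or_lt with rfl | hpos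
  · have : h = 0 := le_antisymm ha h0
    simp [this]
  · have h1 : (a - h) ^ p = (a - h) ^ (p - 1) * (a - h) := by
      rcases (sub_nonneg.2 ha).eq_or_lt with h2 | h2
      · rw [← h2, Real.zero_rpow (by linarith)]; simp
      · rw [← Real.rpow_add_one h2.ne']; congr 1; ring
    have h2 : a ^ p = a ^ (p - 1) * a := by
      rw [← Real.rpow_add_one hpos.ne']; congr 1; ring
    rw [h1, h2, ← mul_sub]
    have : 0 ≤ a - h := sub_nonneg.2 ha
    gcongr
    all_goals linarith

/-! ### Uniform convexity of power type -/

section Convexity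

variable {B : Type*} [NormedAddCommGroup B] [NormedSpace ℝ B]

/-- The constant in the two-point inequality deduced from the modulus `K ε ^ p`. -/
noncomputable def twoPointConst (p K : ℝ) : ℝ :=
  min ((1 / 4) ^ p) ((1 / 2) ^ (p - 1) * (1 / 3 * K * (1 / 2) ^ p))

theorem twoPointConst_pos {p K : ℝ} (hK : 0 < K) : 0 < twoPointConst p K := by
  unfold twoPointConst; positivity

theorem two_point_of_norm_eq_one {p K : ℝ} (hp : 2 ≤ p) (hK : 0 < K)
    (hB : ∀ ε ∈ Set.Ioc (0 : ℝ) 2, ∀ x y : B, ‖x‖ ≤ 1 → ‖y‖ ≤ 1 → ε ≤ ‖x - y‖ →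
      ‖(1 / 2 : ℝ) • (x + y)‖ ≤ 1 - K * ε ^ p) (x y : B) (hx : ‖x‖ = 1) (hy : ‖y‖ ≤ 1) :
    ‖(1 / 2 : ℝ) • (x + y)‖ ^ p + twoPointConst p K * ‖x - y‖ ^ p
      ≤ (1 + ‖y‖ ^ p) / 2 := by
  set s := ‖y‖ with hs
  set D := ‖x - y‖ with hD
  have hs0 : 0 ≤ s := norm_nonneg y
  have hD0 : 0 ≤ D := norm_nonneg _
  have hDs : D ≤ 1 + s := by rw [← hx]; exact norm_sub_le x y
  have hmid : ‖(1 / 2 : ℝ) • (x + y)‖ ≤ (1 + s) / 2 := by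
    rw [norm_smul]
    have := norm_add_le x y
    rw [hx] at this
    norm_num
    linarith
  have hcl := clarkson_scalar hp hs0 hy
  rw [Real.one_rpow] at hcl
  have hc1 : twoPointConst p K ≤ (1 / 4) ^ p := min_le_left _ _
  have hc2 : twoPointConst p K ≤ (1 / 2) ^ (p - 1) * (1 / 3 * K * (1 / 2) ^ p) := min_le_right _ _
  have hDp := Real.rpow_nonneg hD0 p
  rcases lt_or_ge (D / 2) (1 - s) with hcase | hcase
  · have h1 : ‖(1 / 2 : ℝ) • (x + y)‖ ^ p ≤ ((1 + s) / 2) ^ p :=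
      Real.rpow_le_rpow (norm_nonneg _) hmid (by linarith)
    have h2 : (1 / 4) ^ p * D ^ p ≤ ((1 - s) / 2) ^ p := by
      rw [← Real.mul_rpow (by norm_num) hD0]
      exact Real.rpow_le_rpow (by positivity) (by linarith) (by linarith)
    have h3 := mul_le_mul_of_nonneg_right hc1 hDp
    linarith
  · rcases hD0.eq_or_lt with hD1 | hD1
    · have h1 : ‖(1 / 2 : ℝ) • (x + y)‖ ^ p ≤ ((1 + s) / 2) ^ p :=
        Real.rpow_le_rpow (norm_nonneg _) hmid (by linarith)
      have h2 : 0 ≤ ((1 - s) / 2) ^ p := Real.rpow_nonneg (by linarith) _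
      rw [← hD1, Real.zero_rpow (by linarith)]
      linarith
    have hs3 : 1 / 3 ≤ s := by linarith
    have hspos : 0 < s := by linarith
    set y' : B := s⁻¹ • y with hy'
    have hy'n : ‖y'‖ = 1 := by
      rw [hy', norm_smul, norm_inv, Real.norm_of_nonneg hs0, ← hs]
      exact inv_mul_cancel₀ hspos.ne'
    have hyy : y = s • y' := by rw [hy', smul_smul, mul_inv_cancel₀ hspos.ne', one_smul]
    have hdist : ‖y' - y‖ = 1 - s := by
      have : y' - y = (1 - s) • y' := by rw [sub_smul, one_smul, ← hyy]
      rw [this, norm_smul, hy'n, Real.norm_of_nonneg (by linarith), mul_one]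
    have hD' : D / 2 ≤ ‖x - y'‖ := by
      have : D ≤ ‖x - y'‖ + ‖y' - y‖ := by
        rw [hD]; exact norm_sub_le_norm_sub_add_norm_sub x y' y
      linarith
    have hD'2 : ‖x - y'‖ ≤ 2 := by
      have := norm_sub_le x y'
      linarith
    have huc := hB (D / 2) ⟨by linarith, by linarith⟩ x y' hx.le hy'n.le hD'
    have hsplit : (1 / 2 : ℝ) • (x + y) = s • ((1 / 2 : ℝ) • (x + y')) + ((1 - s) / 2) • x := by
      nth_rewrite 1 [hyy]
      module
    set h : ℝ := s * K * (D / 2) ^ p with hh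
    have hh0 : 0 ≤ h := by positivity
    have hmid2 : ‖(1 / 2 : ℝ) • (x + y)‖ ≤ (1 + s) / 2 - h := by
      rw [hsplit]
      refine (norm_add_le _ _).trans ?_
      rw [norm_smul s, norm_smul _ x, hx, Real.norm_of_nonneg hs0,
        Real.norm_of_nonneg (by linarith : 0 ≤ (1 - s) / 2)]
      have := mul_le_mul_of_nonneg_left huc hs0
      rw [hh]
      linarith
    have h1 : ‖(1 / 2 : ℝ) • (x + y)‖ ^ p ≤ ((1 + s) / 2) ^ p - ((1 + s) / 2) ^ (p - 1) * h :=
      (Real.rpow_le_rpow (norm_nonneg _) hmid2 (by linarith)).trans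
        (rpow_sub_le (by linarith) hh0 (by linarith [norm_nonneg ((1 / 2 : ℝ) • (x + y))]))
    have h2 : (1 / 2) ^ (p - 1) * (1 / 3 * K * (1 / 2) ^ p) * D ^ p
        ≤ ((1 + s) / 2) ^ (p - 1) * h := by
      have e : (1 / 2) ^ (p - 1) * (1 / 3 * K * (1 / 2) ^ p) * D ^ p
          = (1 / 2) ^ (p - 1) * (1 / 3 * K * (D / 2) ^ p) := by
        have : D / 2 = 1 / 2 * D := by ring
        rw [this, Real.mul_rpow (by norm_num) hD0]
        ring
      rw [e, hh]
      gcongr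
      · linarith
      · linarith
    have h3 := mul_le_mul_of_nonneg_right hc2 hDp
    have h4 : 0 ≤ ((1 - s) / 2) ^ p := Real.rpow_nonneg (by linarith) _
    linarith

theorem two_point_of_norm_le {p K : ℝ} (hp : 2 ≤ p) (hK : 0 < K)
    (hB : ∀ ε ∈ Set.Ioc (0 : ℝ) 2, ∀ x y : B, ‖x‖ ≤ 1 → ‖y‖ ≤ 1 → ε ≤ ‖x - y‖ →
      ‖(1 / 2 : ℝ) • (x + y)‖ ≤ 1 - K * ε ^ p) (x y : B) (hxy : ‖y‖ ≤ ‖x‖) :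
    ‖(1 / 2 : ℝ) • (x + y)‖ ^ p + twoPointConst p K * ‖x - y‖ ^ p
      ≤ (‖x‖ ^ p + ‖y‖ ^ p) / 2 := by
  rcases (norm_nonneg x).eq_or_lt with hx | hx
  · have hx0 : x = 0 := norm_eq_zero.1 hx.symm
    have hy0 : y = 0 := norm_eq_zero.1 (le_antisymm (hxy.trans hx.symm.le) (norm_nonneg _))
    subst hx0 hy0
    simp [Real.zero_rpow (by linarith : p ≠ 0)]
  · set R := ‖x‖ with hR
    have hscale : ∀ v : B, ‖R⁻¹ • v‖ ^ p = (R ^ p)⁻¹ * ‖v‖ ^ p := by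
      intro v
      rw [norm_smul, norm_inv, Real.norm_of_nonneg hx.le,
        Real.mul_rpow (by positivity) (norm_nonneg _), Real.inv_rpow hx.le]
    have h := two_point_of_norm_eq_one hp hK hB (R⁻¹ • x) (R⁻¹ • y)
      (by rw [norm_smul, norm_inv, Real.norm_of_nonneg hx.le, ← hR, inv_mul_cancel₀ hx.ne'])
      (by rw [norm_smul, norm_inv, Real.norm_of_nonneg hx.le, inv_mul_le_iff₀ hx, mul_one]
          exact hxy)
    rw [← smul_add, ← smul_sub, smul_comm, hscale, hscale, hscale] at h
    have hRp : 0 < R ^ p := by positivity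
    have h2 := mul_le_mul_of_nonneg_left h hRp.le
    have e1 : ∀ c : ℝ, R ^ p * ((R ^ p)⁻¹ * c) = c := fun c => mul_inv_cancel_left₀ hRp.ne' c
    calc ‖(1 / 2 : ℝ) • (x + y)‖ ^ p + twoPointConst p K * ‖x - y‖ ^ p
        = R ^ p * ((R ^ p)⁻¹ * ‖(1 / 2 : ℝ) • (x + y)‖ ^ p
          + twoPointConst p K * ((R ^ p)⁻¹ * ‖x - y‖ ^ p)) := by
          field_simp
      _ ≤ _ := h2
      _ = _ := by field_simp

theorem two_point {p K : ℝ} (hp : 2 ≤ p) (hK : 0 < K)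
    (hB : ∀ ε ∈ Set.Ioc (0 : ℝ) 2, ∀ x y : B, ‖x‖ ≤ 1 → ‖y‖ ≤ 1 → ε ≤ ‖x - y‖ →
      ‖(1 / 2 : ℝ) • (x + y)‖ ≤ 1 - K * ε ^ p) (x y : B) :
    ‖(1 / 2 : ℝ) • (x + y)‖ ^ p + twoPointConst p K * ‖x - y‖ ^ p
      ≤ (‖x‖ ^ p + ‖y‖ ^ p) / 2 := by
  rcases le_total ‖y‖ ‖x‖ with h | h
  · exact two_point_of_norm_le hp hK hB x y h
  · have := two_point_of_norm_le hp hK hB y x h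
    rwa [add_comm y x, norm_sub_rev y x, add_comm (‖y‖ ^ p)] at this

/-- `‖·‖ ^ p` lies above each of its tangent functionals by at least `δ ‖· - z‖ ^ p`. -/
def UniformlyAboveTangents (B : Type*) [NormedAddCommGroup B] [NormedSpace ℝ B] (p δ : ℝ) : Prop :=
  ∀ z : B, ∃ l : B →L[ℝ] ℝ, ∀ x : B, ‖z‖ ^ p + l (x - z) + δ * ‖x - z‖ ^ p ≤ ‖x‖ ^ p

theorem exists_norming (z : B) : ∃ l : B →L[ℝ] ℝ, ∀ x : B, ‖z‖ + l (x - z) ≤ ‖x‖ := by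
  obtain ⟨g, hg, hgz⟩ := exists_dual_vector'' ℝ z
  refine ⟨g, fun x => ?_⟩
  have h : g x ≤ ‖x‖ := by
    have := g.le_of_opNorm_le hg x
    rw [one_mul] at this
    exact (le_abs_self _).trans this
  rw [map_sub, hgz]
  simpa using h

theorem uniformlyAboveTangents {p K : ℝ} (hp : 2 ≤ p) (hK : 0 < K)
    (hB : ∀ ε ∈ Set.Ioc (0 : ℝ) 2, ∀ x y : B, ‖x‖ ≤ 1 → ‖y‖ ≤ 1 → ε ≤ ‖x - y‖ →
      ‖(1 / 2 : ℝ) • (x + y)‖ ≤ 1 - K * ε ^ p) :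
    UniformlyAboveTangents B p (2 * twoPointConst p K) := by
  intro z
  obtain ⟨g, hg⟩ := exists_norming z
  refine ⟨(p * ‖z‖ ^ (p - 1)) • g, fun x => ?_⟩
  have h1 := two_point hp hK hB x z
  have h2 := rpow_tangent_le (p := p) (by linarith) (norm_nonneg z)
    (norm_nonneg ((1 / 2 : ℝ) • (x + z)))
  have h3 := hg ((1 / 2 : ℝ) • (x + z))
  have e : (1 / 2 : ℝ) • (x + z) - z = (1 / 2 : ℝ) • (x - z) := by module
  rw [e, map_smul, smul_eq_mul] at h3
  have hc : 0 ≤ p * ‖z‖ ^ (p - 1) := by positivity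
  have h4 := mul_le_mul_of_nonneg_left (by linarith :
    1 / 2 * g (x - z) ≤ ‖(1 / 2 : ℝ) • (x + z)‖ - ‖z‖) hc
  rw [smul_apply, smul_eq_mul]
  linarith

end Convexity

/-! ### Block sums and dyadic averages on `ℤ` -/

section Blocks

/-- The sum of `h` over the `a`-th block of length `L`. -/
def blockSum {V : Type*} [AddCommMonoid V] (L : ℕ) (h : ℤ → V) (a : ℤ) : V :=
  ∑ r ∈ range L, h (L * a + r)

/-- `h` is constant on the blocks of length `L`. -/
def BlockConst {α : Type*} (L : ℕ) (h : ℤ → α) : Prop :=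
  ∀ x y : ℤ, x / L = y / L → h x = h y

theorem mul_add_ediv_of_lt {L r : ℕ} (a : ℤ) (hr : r < L) : ((L : ℤ) * a + r) / L = a := by
  have hL : (L : ℤ) ≠ 0 := by omega
  rw [Int.mul_add_ediv_left _ _ hL, Int.ediv_eq_zero_of_lt (by omega) (by omega), add_zero]

theorem BlockConst.of_mul {α : Type*} {L m : ℕ} {h : ℤ → α} (hh : BlockConst (L * m) h) :
    BlockConst L h := by
  intro x y hxy
  apply hh
  push_cast
  rw [← Int.ediv_ediv_of_nonneg (by positivity), ← Int.ediv_ediv_of_nonneg (by positivity), hxy]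

theorem BlockConst.of_two_pow_le {α : Type*} {j k : ℕ} (hjk : j ≤ k) {h : ℤ → α}
    (hh : BlockConst (2 ^ k) h) : BlockConst (2 ^ j) h := by
  obtain ⟨m, rfl⟩ := Nat.exists_eq_add_of_le hjk
  rw [pow_add] at hh
  exact hh.of_mul

theorem BlockConst.apply_mul_add {α : Type*} {L r : ℕ} {h : ℤ → α} (hh : BlockConst L h) (a : ℤ)
    (hr : r < L) : h (L * a + r) = h (L * a) := by
  apply hh
  rw [mul_add_ediv_of_lt a hr]
  have := mul_add_ediv_of_lt a (Nat.zero_lt_of_lt hr)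
  simpa using this.symm

theorem sum_range_mul_eq {V : Type*} [AddCommMonoid V] (L m : ℕ) (g : ℕ → V) :
    ∑ r ∈ range (L * m), g r = ∑ b ∈ range m, ∑ r ∈ range L, g (L * b + r) := by
  induction m with
  | zero => simp
  | succ m ih => rw [mul_add, mul_one, sum_range_add, ih, sum_range_succ]

theorem blockSum_mul {V : Type*} [AddCommMonoid V] (L m : ℕ) (h : ℤ → V) (a : ℤ) :
    blockSum (L * m) h a = ∑ b ∈ range m, blockSum L h (m * a + b) := by
  unfold blockSum
  rw [sum_range_mul_eq]
  refine sum_congr rfl fun b _ => sum_congr rfl fun r _ => ?_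
  congr 1
  push_cast
  ring

theorem tsum_eq_tsum_blockSum {L : ℕ} (hL : 0 < L) (h : ℤ → ℝ≥0∞) :
    ∑' x, h x = ∑' a, blockSum L h a := by
  have : NeZero L := ⟨hL.ne'⟩
  rw [← (Int.divModEquiv L).symm.tsum_eq, ENNReal.tsum_prod']
  refine tsum_congr fun a => ?_
  rw [tsum_fintype, blockSum, ← Fin.sum_univ_eq_sum_range (fun r => h (L * a + r))]
  refine sum_congr rfl fun r _ => ?_
  simp [Int.divModEquiv, mul_comm]

theorem blockSum_le_blockSum {L : ℕ} {g h : ℤ → ℝ} (hgh : ∀ x, g x ≤ h x) (a : ℤ) :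
    blockSum L g a ≤ blockSum L h a :=
  sum_le_sum fun _ _ => hgh _

theorem blockSum_add {V : Type*} [AddCommMonoid V] (L : ℕ) (g h : ℤ → V) (a : ℤ) :
    blockSum L (fun x => g x + h x) a = blockSum L g a + blockSum L h a :=
  sum_add_distrib

theorem blockSum_mul_left (L : ℕ) (c : ℝ) (h : ℤ → ℝ) (a : ℤ) :
    blockSum L (fun x => c * h x) a = c * blockSum L h a :=
  (mul_sum _ _ _).symm

theorem ofReal_blockSum {L : ℕ} {h : ℤ → ℝ} (hh : ∀ x, 0 ≤ h x) (a : ℤ) :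
    ENNReal.ofReal (blockSum L h a) = blockSum L (fun x => ENNReal.ofReal (h x)) a :=
  ENNReal.ofReal_sum_of_nonneg fun _ _ => hh _

/-- An inequality between the sums over all blocks of a given length passes to the sums
over `ℤ`. -/
theorem tsum_ofReal_le_of_blockSum_le {L : ℕ} (hL : 0 < L) {g h : ℤ → ℝ} (hg : ∀ x, 0 ≤ g x)
    (hh : ∀ x, 0 ≤ h x) (hgh : ∀ a, blockSum L g a ≤ blockSum L h a) :
    ∑' x, ENNReal.ofReal (g x) ≤ ∑' x, ENNReal.ofReal (h x) := by
  rw [tsum_eq_tsum_blockSum hL (fun x => ENNReal.ofReal (g x)),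
    tsum_eq_tsum_blockSum hL (fun x => ENNReal.ofReal (h x))]
  refine ENNReal.tsum_le_tsum fun a => ?_
  rw [← ofReal_blockSum hg, ← ofReal_blockSum hh]
  exact ENNReal.ofReal_le_ofReal (hgh a)

variable {B : Type*} [NormedAddCommGroup B] [NormedSpace ℝ B]

/-- The average of `f` over the dyadic block of length `2 ^ k` containing `x`. -/
noncomputable def dyadicAvg (k : ℕ) (f : ℤ → B) (x : ℤ) : B :=
  ((2 : ℝ) ^ k)⁻¹ • blockSum (2 ^ k) f (x / (2 ^ k : ℕ))

theorem dyadicAvg_zero (f : ℤ → B) : dyadicAvg 0 f = f := by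
  funext x
  simp [dyadicAvg, blockSum]

theorem blockConst_dyadicAvg (k : ℕ) (f : ℤ → B) : BlockConst (2 ^ k) (dyadicAvg k f) := by
  intro x y hxy
  unfold dyadicAvg
  rw [hxy]

theorem blockSum_dyadicAvg_self (k : ℕ) (f : ℤ → B) (a : ℤ) :
    blockSum (2 ^ k) (dyadicAvg k f) a = blockSum (2 ^ k) f a := by
  have h : ∀ r ∈ range (2 ^ k), dyadicAvg k f ((2 ^ k : ℕ) * a + r)
      = ((2 : ℝ) ^ k)⁻¹ • blockSum (2 ^ k) f a := by
    intro r hr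
    unfold dyadicAvg
    rw [mul_add_ediv_of_lt a (mem_range.1 hr)]
  rw [blockSum, sum_congr rfl h, sum_const, card_range, ← Nat.cast_smul_eq_nsmul ℝ, smul_smul]
  push_cast
  rw [mul_inv_cancel₀ (by positivity), one_smul]

theorem blockSum_dyadicAvg {k m : ℕ} (hkm : k ≤ m) (f : ℤ → B) (a : ℤ) :
    blockSum (2 ^ m) (dyadicAvg k f) a = blockSum (2 ^ m) f a := by
  obtain ⟨i, rfl⟩ := Nat.exists_eq_add_of_le hkm
  rw [pow_add, blockSum_mul, blockSum_mul]
  exact sum_congr rfl fun b _ => blockSum_dyadicAvg_self k f _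

theorem blockSum_dyadicAvg_sub (k : ℕ) (f : ℤ → B) (a : ℤ) :
    blockSum (2 ^ (k + 1)) (fun x => dyadicAvg k f x - dyadicAvg (k + 1) f x) a = 0 := by
  have h : blockSum (2 ^ (k + 1)) (fun x => dyadicAvg k f x - dyadicAvg (k + 1) f x) a
      = blockSum (2 ^ (k + 1)) (dyadicAvg k f) a
        - blockSum (2 ^ (k + 1)) (dyadicAvg (k + 1) f) a := sum_sub_distrib _ _
  rw [h, blockSum_dyadicAvg (Nat.le_succ k), blockSum_dyadicAvg le_rfl, sub_self]

theorem blockSum_apply_dyadicAvg_sub {k N : ℕ} (hkN : k + 1 ≤ N) (f : ℤ → B)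
    (l : ℤ → B →L[ℝ] ℝ) (hl : BlockConst (2 ^ (k + 1)) l) (a : ℤ) :
    blockSum (2 ^ N) (fun x => l x (dyadicAvg k f x - dyadicAvg (k + 1) f x)) a = 0 := by
  obtain ⟨i, rfl⟩ := Nat.exists_eq_add_of_le hkN
  rw [pow_add, blockSum_mul]
  refine sum_eq_zero fun b _ => ?_
  set c : ℤ := (2 ^ i : ℕ) * a + b
  have h := congrArg (l ((2 ^ (k + 1) : ℕ) * c)) (blockSum_dyadicAvg_sub k f c)
  rw [map_zero, blockSum, map_sum] at h
  rw [← h]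
  refine sum_congr rfl fun r hr => ?_
  beta_reduce
  rw [hl.apply_mul_add c (mem_range.1 hr)]

end Blocks

/-! ### Stopped paths -/

section Paths

variable {B : Type*} [NormedAddCommGroup B]

/-- The running maximum of the norm along a path. -/
noncomputable def runMax (X : ℕ → B) : ℕ → ℝ
  | 0 => ‖X 0‖
  | s + 1 => max (runMax X s) ‖X (s + 1)‖

open Classical in
/-- The value of the path at the last of the successive times at which it has moved by at least
`θ` times the running maximum. -/
noncomputable def anchor (θ : ℝ) (X : ℕ → B) : ℕ → B
  | 0 => X 0
  | s + 1 => if θ * runMax X (s + 1) ≤ ‖X (s + 1) - anchor θ X s‖ then X (s + 1) else anchor θ X s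

theorem runMax_congr {X Y : ℕ → B} {s : ℕ} (h : ∀ r ≤ s, X r = Y r) :
    runMax X s = runMax Y s := by
  induction s with
  | zero => simp [runMax, h 0 le_rfl]
  | succ s ih => simp [runMax, h (s + 1) le_rfl, ih fun r hr => h r (hr.trans s.le_succ)]

theorem anchor_congr {θ : ℝ} {X Y : ℕ → B} {s : ℕ} (h : ∀ r ≤ s, X r = Y r) :
    anchor θ X s = anchor θ Y s := by
  induction s with
  | zero => simp [anchor, h 0 le_rfl]
  | succ s ih =>
    rw [anchor, anchor, h (s + 1) le_rfl, ih fun r hr => h r (hr.trans s.le_succ), runMax_congr h]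

theorem norm_le_runMax (X : ℕ → B) (s : ℕ) : ‖X s‖ ≤ runMax X s := by
  cases s with
  | zero => exact le_rfl
  | succ s => exact le_max_right _ _

theorem runMax_nonneg (X : ℕ → B) (s : ℕ) : 0 ≤ runMax X s :=
  (norm_nonneg _).trans (norm_le_runMax X s)

theorem runMax_mono (X : ℕ → B) : Monotone (runMax X) :=
  monotone_nat_of_le_succ fun _ => le_max_left _ _

theorem anchor_zero_eq (X : ℕ → B) (s : ℕ) : anchor 0 X s = X s := by
  cases s with
  | zero => rfl
  | succ s => simp [anchor]

theorem anchor_succ_eq_or (θ : ℝ) (X : ℕ → B) (s : ℕ) :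
    anchor θ X (s + 1) = X (s + 1) ∨ anchor θ X (s + 1) = anchor θ X s := by
  rw [anchor]
  split_ifs <;> simp

theorem norm_sub_anchor_le {θ : ℝ} (hθ : 0 ≤ θ) (X : ℕ → B) (s : ℕ) :
    ‖X s - anchor θ X s‖ ≤ θ * runMax X s := by
  have h0 : ∀ s, 0 ≤ θ * runMax X s := fun s => mul_nonneg hθ (runMax_nonneg X s)
  cases s with
  | zero => simpa [anchor] using h0 0
  | succ s =>
    rw [anchor]
    split_ifs with h
    · simpa using h0 (s + 1)
    · exact (not_le.1 h).le

/-- Either the anchor has not moved between `s` and `t`, or its last move is at a time at which the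
running maximum is comparable with the one at time `t`. -/
theorem anchor_eq_or_exists_jump {θ : ℝ} (X : ℕ → B) (s : ℕ) {t : ℕ} (hst : s ≤ t) :
    anchor θ X t = anchor θ X s ∨ ∃ u, s ≤ u ∧ u < t ∧
      θ * runMax X (u + 1) ≤ ‖anchor θ X (u + 1) - anchor θ X u‖ ∧
      runMax X t ≤ max (runMax X (u + 1)) (runMax X (u + 1) + θ * runMax X t) ∧
      anchor θ X t = X (u + 1) := by
  induction t, hst using Nat.le_induction with
  | base => exact Or.inl rfl
  | succ t hst ih =>
    by_cases hj : θ * runMax X (t + 1) ≤ ‖X (t + 1) - anchor θ X t‖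
    · have e : anchor θ X (t + 1) = X (t + 1) := by rw [anchor, if_pos hj]
      exact Or.inr ⟨t, hst, t.lt_succ_self, by rwa [e], le_max_left _ _, e⟩
    · have e : anchor θ X (t + 1) = anchor θ X t := by rw [anchor, if_neg hj]
      rw [e]
      rcases ih with ih | ⟨u, hsu, hut, h1, h2, h3⟩
      · exact Or.inl ih
      · refine Or.inr ⟨u, hsu, hut.trans t.lt_succ_self, h1, ?_, h3⟩
        rcases le_total ‖X (t + 1)‖ (runMax X t) with hc | hc
        · have e2 : runMax X (t + 1) = runMax X t := max_eq_left hc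
          rwa [e2]
        · have e2 : runMax X (t + 1) = ‖X (t + 1)‖ := max_eq_right hc
          refine le_max_of_le_right ?_
          rw [h3] at hj
          have h4 : ‖X (t + 1)‖ ≤ ‖X (t + 1) - X (u + 1)‖ + ‖X (u + 1)‖ := by
            simpa using norm_add_le (X (t + 1) - X (u + 1)) (X (u + 1))
          have h5 := norm_le_runMax X (u + 1)
          linarith [not_le.1 hj]

/-- A large increment of the path forces a comparable move of the anchor. -/
theorem exists_anchor_jump {θ : ℝ} (hθ0 : 0 ≤ θ) (hθ : θ ≤ 1 / 2) (X : ℕ → B) {s t : ℕ}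
    (hst : s ≤ t) (h : 2 * θ * runMax X t < ‖X t - X s‖) :
    ∃ u, s ≤ u ∧ u < t ∧ θ * runMax X t ≤ 2 * ‖anchor θ X (u + 1) - anchor θ X u‖ := by
  rcases anchor_eq_or_exists_jump (θ := θ) X s hst with he | ⟨u, hsu, hut, h1, h2, -⟩
  · exfalso
    have h1 := norm_sub_anchor_le hθ0 X s
    have h2 := norm_sub_anchor_le hθ0 X t
    have h3 := mul_le_mul_of_nonneg_left (runMax_mono X hst) hθ0
    rw [he] at h2
    rw [norm_sub_rev] at h1
    have h4 := norm_sub_le_norm_sub_add_norm_sub (X t) (anchor θ X s) (X s)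
    linarith
  · refine ⟨u, hsu, hut, ?_⟩
    have h3 := runMax_nonneg X t
    have h4 : runMax X t ≤ 2 * runMax X (u + 1) := by
      have h5 : θ * runMax X t ≤ 1 / 2 * runMax X t := by gcongr
      have h6 := runMax_nonneg X (u + 1)
      rcases le_max_iff.1 h2 with h2 | h2 <;> linarith
    have h5 := mul_le_mul_of_nonneg_left h4 hθ0
    linarith

end Paths

/-! ### Martingale inequalities for dyadic averages -/

section Martingale

variable {B : Type*} [NormedAddCommGroup B] [NormedSpace ℝ B]

/-- The path of the dyadic martingale at `x`, from the blocks of length `2 ^ N` down to points. -/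
noncomputable def dyadicPath (N : ℕ) (f : ℤ → B) (x : ℤ) (s : ℕ) : B :=
  dyadicAvg (N - s) f x

theorem dyadicPath_congr {N s : ℕ} (f : ℤ → B) {x y : ℤ}
    (h : x / (2 ^ (N - s) : ℕ) = y / (2 ^ (N - s) : ℕ)) :
    ∀ r ≤ s, dyadicPath N f x r = dyadicPath N f y r := fun r hr =>
  (blockConst_dyadicAvg (N - r) f).of_two_pow_le (by omega : N - s ≤ N - r) x y h

theorem blockSum_apply_dyadicPath_sub {N s : ℕ} (hs : s < N) (f : ℤ → B)
    (l : ℤ → B →L[ℝ] ℝ) (hl : BlockConst (2 ^ (N - s)) l) (a : ℤ) :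
    blockSum (2 ^ N) (fun x => l x (dyadicPath N f x (s + 1) - dyadicPath N f x s)) a = 0 := by
  have e : N - s = N - (s + 1) + 1 := by omega
  simp only [dyadicPath]
  rw [e] at hl ⊢
  exact blockSum_apply_dyadicAvg_sub (by omega) f l hl a

theorem blockSum_anchor_le {p δ : ℝ} (hB : UniformlyAboveTangents B p δ) (hδ : 0 ≤ δ)
    (θ : ℝ) (N : ℕ) (f : ℤ → B) (a : ℤ) :
    blockSum (2 ^ N) (fun x => ‖dyadicAvg N f x‖ ^ p + δ * ∑ s ∈ range N,
      ‖anchor θ (dyadicPath N f x) (s + 1) - anchor θ (dyadicPath N f x) s‖ ^ p) a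
      ≤ blockSum (2 ^ N) (fun x => ‖f x‖ ^ p) a := by
  choose l hl using hB
  set X := fun (x : ℤ) (s : ℕ) => dyadicPath N f x s with hX
  set Z := fun (x : ℤ) (s : ℕ) => anchor θ (dyadicPath N f x) s with hZ
  set S := fun (x : ℤ) (s : ℕ) => ∑ r ∈ range s, ‖Z x (r + 1) - Z x r‖ ^ p with hS
  have hmono : ∀ s ≤ N, blockSum (2 ^ N) (fun x => ‖dyadicAvg N f x‖ ^ p) a ≤
      blockSum (2 ^ N) (fun x => ‖Z x s‖ ^ p + l (Z x s) (X x s - Z x s) - δ * S x s) a := by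
    intro s
    induction s with
    | zero =>
      intro _
      refine blockSum_le_blockSum (fun x => ?_) a
      simp [hX, hZ, hS, anchor, dyadicPath]
    | succ s ih =>
      intro hs
      refine (ih (by omega)).trans ?_
      have horth := blockSum_apply_dyadicPath_sub (by omega : s < N) f (fun x => l (Z x s))
        (fun x y hxy => congrArg l (anchor_congr (dyadicPath_congr f hxy))) a
      rw [← add_zero (blockSum _ _ a), ← horth, ← blockSum_add]
      refine blockSum_le_blockSum (fun x => ?_) a
      have hSs : S x (s + 1) = S x s + ‖Z x (s + 1) - Z x s‖ ^ p := sum_range_succ _ _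
      have hl1 := hl (Z x s) (X x (s + 1))
      rw [hSs]
      change _ + _ - _ + l (Z x s) (X x (s + 1) - X x s) ≤ _
      have hlin : l (Z x s) (X x (s + 1) - Z x s)
          = l (Z x s) (X x (s + 1) - X x s) + l (Z x s) (X x s - Z x s) := by
        rw [← map_add]; congr 1; abel
      rcases anchor_succ_eq_or θ (dyadicPath N f x) s with h | h
      · have h' : Z x (s + 1) = X x (s + 1) := h
        rw [h', sub_self, map_zero]
        linarith
      · have h' : Z x (s + 1) = Z x s := h
        rw [h', sub_self]
        have hp0 : δ * ‖(0 : B)‖ ^ p ≤ 0 := by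
          have h0 := hl (Z x s) (Z x s)
          rw [sub_self, map_zero] at h0
          linarith
        have h0 : 0 ≤ δ * ‖X x (s + 1) - Z x s‖ ^ p := by positivity
        linarith
  have hN := hmono N le_rfl
  have hfin : ∀ x, (‖Z x N‖ ^ p + l (Z x N) (X x N - Z x N) - δ * S x N) + δ * S x N
      ≤ ‖f x‖ ^ p := by
    intro x
    have h1 := hl (Z x N) (f x)
    have h2 : X x N = f x := by simp [hX, dyadicPath, dyadicAvg_zero]
    have h3 : 0 ≤ δ * ‖f x - Z x N‖ ^ p := by positivity
    rw [h2]
    linarith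
  calc _ = blockSum (2 ^ N) (fun x => ‖dyadicAvg N f x‖ ^ p) a
        + blockSum (2 ^ N) (fun x => δ * S x N) a := blockSum_add _ _ _ _
    _ ≤ _ := by gcongr
    _ = _ := (blockSum_add _ _ _ _).symm
    _ ≤ _ := blockSum_le_blockSum hfin a

/-- The Doob maximal inequality for the dyadic martingale. -/
theorem blockSum_runMax_rpow_le {p : ℝ} (hp : 2 ≤ p) (N : ℕ) (f : ℤ → B) (a : ℤ) :
    blockSum (2 ^ N) (fun x => runMax (dyadicPath N f x) N ^ p) a
      ≤ blockSum (2 ^ N) (fun x => 4 ^ p * ‖f x‖ ^ p) a := by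
  choose g hg using exists_norming (B := B)
  set X := fun (x : ℤ) (s : ℕ) => dyadicPath N f x s with hX
  set M := fun (x : ℤ) (s : ℕ) => runMax (dyadicPath N f x) s with hM
  have hM0 : ∀ x s, 0 ≤ M x s := fun x s => runMax_nonneg _ _
  have hsplit : ∀ u : ℝ, 0 ≤ u → u ^ p = u ^ (p - 1) * u := by
    intro u hu
    rcases hu.eq_or_lt with rfl | hu
    · rw [Real.zero_rpow (by linarith), mul_zero]
    · rw [← Real.rpow_add_one hu.ne']; congr 1; ring
  have hmono : ∀ s ≤ N,
      blockSum (2 ^ N) (fun x => M x s ^ p - 2 * M x s ^ (p - 1) * ‖X x s‖) a ≤ 0 := by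
    intro s
    induction s with
    | zero =>
      intro _
      refine sum_nonpos fun r _ => ?_
      have h0 : ∀ x, M x 0 = ‖X x 0‖ := fun x => rfl
      simp only [h0]
      rw [hsplit _ (norm_nonneg _)]
      have : 0 ≤ ‖X ((2 ^ N : ℕ) * a + r) 0‖ ^ (p - 1) * ‖X ((2 ^ N : ℕ) * a + r) 0‖ := by
        positivity
      linarith
    | succ s ih =>
      intro hs
      refine le_trans ?_ (ih (by omega))
      have horth := blockSum_apply_dyadicPath_sub (by omega : s < N) f
        (fun x => (-(2 * M x s ^ (p - 1))) • g (X x s))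
        (fun x y hxy => by
          have h1 := dyadicPath_congr f hxy
          have h2 : M x s = M y s := runMax_congr h1
          have h3 : X x s = X y s := h1 s le_rfl
          simp only [h2, h3]) a
      rw [← add_zero (blockSum (2 ^ N) (fun x => M x s ^ p - 2 * M x s ^ (p - 1) * ‖X x s‖) a),
        ← horth, ← blockSum_add]
      refine blockSum_le_blockSum (fun x => ?_) a
      have h1 := hg (X x s) (X x (s + 1))
      change _ ≤ _ + ((-(2 * M x s ^ (p - 1))) • g (X x s)) (X x (s + 1) - X x s)
      rw [smul_apply, smul_eq_mul]
      have hMp : 0 ≤ M x s ^ (p - 1) := Real.rpow_nonneg (hM0 x s) _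
      have h2 := mul_le_mul_of_nonneg_left h1 hMp
      have h3 : M x (s + 1) ^ p - 2 * M x (s + 1) ^ (p - 1) * ‖X x (s + 1)‖
          ≤ M x s ^ p - 2 * M x s ^ (p - 1) * ‖X x (s + 1)‖ := by
        rcases le_total ‖X x (s + 1)‖ (M x s) with hc | hc
        · have e : M x (s + 1) = M x s := max_eq_left hc
          rw [e]
        · have e : M x (s + 1) = ‖X x (s + 1)‖ := max_eq_right hc
          rw [e]
          have h4 := rpow_tangent_le (p := p) (by linarith) (hM0 x s) (norm_nonneg (X x (s + 1)))
          have h5 := hsplit _ (norm_nonneg (X x (s + 1)))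
          have h6 := hsplit _ (hM0 x s)
          have h7 : 0 ≤ (p - 2) * (M x s ^ (p - 1) * (‖X x (s + 1)‖ - M x s)) :=
            mul_nonneg (by linarith) (mul_nonneg hMp (by linarith))
          nlinarith
      linarith
  have hfin : ∀ x, M x N ^ p ≤ 4 ^ p * ‖f x‖ ^ p
      + 2 * (M x N ^ p - 2 * M x N ^ (p - 1) * ‖X x N‖) := by
    intro x
    have h2 : X x N = f x := by simp [hX, dyadicPath, dyadicAvg_zero]
    rw [h2]
    have hMp : 0 ≤ M x N ^ (p - 1) := Real.rpow_nonneg (hM0 x N) _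
    have h5 := hsplit _ (hM0 x N)
    have h6 : (4 : ℝ) ^ p * ‖f x‖ ^ p = (4 * ‖f x‖) ^ p :=
      (Real.mul_rpow (by norm_num) (norm_nonneg _)).symm
    have h7 : 0 ≤ (4 * ‖f x‖) ^ p := by positivity
    rcases le_total (4 * ‖f x‖) (M x N) with hc | hc
    · have := mul_le_mul_of_nonneg_left hc hMp
      rw [h6]
      nlinarith
    · have h8 : M x N ^ (p - 1) ≤ (4 * ‖f x‖) ^ (p - 1) :=
        Real.rpow_le_rpow (hM0 x N) hc (by linarith)
      have h9 := hsplit (4 * ‖f x‖) (by positivity)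
      have h10 := mul_le_mul_of_nonneg_right h8 (by positivity : 0 ≤ 4 * ‖f x‖)
      have h11 : 0 ≤ M x N ^ p := Real.rpow_nonneg (hM0 x N) _
      rw [h6]
      nlinarith
  refine (blockSum_le_blockSum hfin a).trans ?_
  rw [blockSum_add, blockSum_mul_left _ 2]
  linarith [hmono N le_rfl]

theorem tsum_runMax_rpow_le {p : ℝ} (hp : 2 ≤ p) (N : ℕ) (f : ℤ → B) :
    ∑' x, ENNReal.ofReal (runMax (dyadicPath N f x) N ^ p)
      ≤ ENNReal.ofReal (4 ^ p) * ∑' x, ENNReal.ofReal (‖f x‖ ^ p) := by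
  refine (tsum_ofReal_le_of_blockSum_le (pow_pos two_pos N)
    (fun x => Real.rpow_nonneg (runMax_nonneg _ _) _) (fun x => by positivity)
    (blockSum_runMax_rpow_le hp N f)).trans_eq ?_
  rw [← ENNReal.tsum_mul_left]
  exact tsum_congr fun x => ENNReal.ofReal_mul (by positivity)

theorem tsum_anchor_le {p δ : ℝ} (hB : UniformlyAboveTangents B p δ) (hδ : 0 < δ)
    (θ : ℝ) (N : ℕ) (f : ℤ → B) :
    ∑' x, (ENNReal.ofReal (‖dyadicAvg N f x‖ ^ p) + ENNReal.ofReal δ * ∑ s ∈ range N,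
      ENNReal.ofReal
        (‖anchor θ (dyadicPath N f x) (s + 1) - anchor θ (dyadicPath N f x) s‖ ^ p))
      ≤ ∑' x, ENNReal.ofReal (‖f x‖ ^ p) := by
  refine le_of_eq_of_le ?_ (tsum_ofReal_le_of_blockSum_le (pow_pos two_pos N)
    (fun x => by positivity) (fun x => by positivity) (blockSum_anchor_le hB hδ.le θ N f))
  refine tsum_congr fun x => ?_
  rw [ENNReal.ofReal_add (by positivity) (by positivity), ENNReal.ofReal_mul hδ.le,
    ENNReal.ofReal_sum_of_nonneg fun _ _ => by positivity]

end Martingale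

/-! ### Variation along a path -/

section Variation

variable {B : Type*} [NormedAddCommGroup B]

theorem exists_scale_norm_sub_rpow_le {p q : ℝ} (hp : 0 ≤ p) (hpq : p ≤ q) (X : ℕ → B)
    {s t T : ℕ} (hst : s ≤ t) (htT : t ≤ T) (hne : X t ≠ X s) :
    ∃ m u : ℕ, s ≤ u ∧ u < t ∧ ‖X t - X s‖ ^ q ≤ 4 ^ q * 2 ^ p * runMax X T ^ (q - p) *
      (((1 / 2 : ℝ) ^ (m + 1)) ^ (q - p) *
        ‖anchor ((1 / 2) ^ (m + 1)) X (u + 1) - anchor ((1 / 2) ^ (m + 1)) X u‖ ^ p) := by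
  have hr : 0 < ‖X t - X s‖ := norm_pos_iff.2 (sub_ne_zero.2 hne)
  have hr2 : ‖X t - X s‖ ≤ 2 * runMax X t := by
    have h1 := norm_sub_le (X t) (X s)
    have h2 := norm_le_runMax X t
    have h3 := (norm_le_runMax X s).trans (runMax_mono X hst)
    linarith
  have hM : 0 < runMax X t := by linarith
  obtain ⟨m, hm1, hm2⟩ := exists_nat_pow_near_of_lt_one
    (div_pos hr (by positivity : 0 < 2 * runMax X t)) ((div_le_one (by positivity)).2 hr2)
    (by norm_num : (0 : ℝ) < 1 / 2) (by norm_num)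
  rw [lt_div_iff₀ (by positivity)] at hm1
  rw [div_le_iff₀ (by positivity)] at hm2
  set θ : ℝ := (1 / 2) ^ (m + 1) with hθ
  have hθ0 : 0 < θ := by positivity
  have hθ2 : (1 / 2 : ℝ) ^ m = 2 * θ := by rw [hθ, pow_succ]; ring
  have hθ1 : θ ≤ 1 / 2 := by
    have : (1 / 2 : ℝ) ^ m ≤ 1 := pow_le_one₀ (by norm_num) (by norm_num)
    linarith
  obtain ⟨u, hsu, hut, hu⟩ := exists_anchor_jump hθ0.le hθ1 X hst (by linarith)
  refine ⟨m, u, hsu, hut, ?_⟩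
  have hrle : ‖X t - X s‖ ≤ 4 * (θ * runMax X t) := by rw [hθ2] at hm2; linarith
  have hMT := runMax_mono X htT
  have hθM : 0 < θ * runMax X t := by positivity
  set D := ‖anchor θ X (u + 1) - anchor θ X u‖
  calc ‖X t - X s‖ ^ q ≤ (4 * (θ * runMax X t)) ^ q :=
        Real.rpow_le_rpow hr.le hrle (by linarith)
    _ = 4 ^ q * ((θ * runMax X t) ^ (q - p) * (θ * runMax X t) ^ p) := by
        rw [Real.mul_rpow (by norm_num) hθM.le, ← Real.rpow_add hθM]
        congr 2; ring
    _ ≤ 4 ^ q * ((θ * runMax X T) ^ (q - p) * (2 * D) ^ p) := by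
        have h1 : 0 ≤ q - p := by linarith
        have h2 : 0 ≤ (θ * runMax X T) ^ (q - p) := by
          have := runMax_nonneg X T
          positivity
        gcongr
    _ = _ := by
        rw [Real.mul_rpow hθ0.le (runMax_nonneg X T), Real.mul_rpow (by norm_num) (norm_nonneg _)]
        ring

/-- The weighted sum over all scales of the `p`-th powers of the moves of the anchors. -/
noncomputable def anchorSum (p q : ℝ) (X : ℕ → B) (T : ℕ) : ℝ≥0∞ :=
  ∑' m : ℕ, ENNReal.ofReal (((1 / 2 : ℝ) ^ (m + 1)) ^ (q - p)) * ∑ u ∈ range T, ENNReal.ofReal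
    (‖anchor ((1 / 2) ^ (m + 1)) X (u + 1) - anchor ((1 / 2) ^ (m + 1)) X u‖ ^ p)

theorem sum_Ico_antitone {V : Type*} [AddCommMonoid V] (F : ℕ → V) {τ : ℕ → ℕ} (hτ : Antitone τ)
    (m : ℕ) : ∑ i ∈ range m, ∑ u ∈ Ico (τ (i + 1)) (τ i), F u = ∑ u ∈ Ico (τ m) (τ 0), F u := by
  induction m with
  | zero => simp
  | succ m ih =>
    rw [sum_range_succ, ih, add_comm]
    exact sum_Ico_consecutive F (hτ m.le_succ) (hτ m.zero_le)

theorem sum_norm_sub_rpow_le_anchorSum {p q : ℝ} (hp : 0 ≤ p) (hq : 0 < q) (hpq : p ≤ q)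
    (X : ℕ → B) {τ : ℕ → ℕ} (hτ : Antitone τ) {T : ℕ} (hT : τ 0 ≤ T) (m : ℕ) :
    ∑ i ∈ range m, ENNReal.ofReal (‖X (τ i) - X (τ (i + 1))‖ ^ q)
      ≤ ENNReal.ofReal (4 ^ q * 2 ^ p * runMax X T ^ (q - p)) * anchorSum p q X T := by
  set c : ℝ := 4 ^ q * 2 ^ p * runMax X T ^ (q - p) with hc
  have hc0 : 0 ≤ c := by
    have := Real.rpow_nonneg (runMax_nonneg X T) (q - p)
    positivity
  set w : ℕ → ℝ≥0∞ := fun m => ENNReal.ofReal (((1 / 2 : ℝ) ^ (m + 1)) ^ (q - p)) with hw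
  set F : ℕ → ℕ → ℝ≥0∞ := fun m u => ENNReal.ofReal
    (‖anchor ((1 / 2) ^ (m + 1)) X (u + 1) - anchor ((1 / 2) ^ (m + 1)) X u‖ ^ p) with hF
  have hone : ∀ i, ENNReal.ofReal (‖X (τ i) - X (τ (i + 1))‖ ^ q) ≤
      ENNReal.ofReal c * ∑' m, w m * ∑ u ∈ Ico (τ (i + 1)) (τ i), F m u := by
    intro i
    by_cases hne : X (τ i) = X (τ (i + 1))
    · simp [hne, Real.zero_rpow hq.ne']
    obtain ⟨m, u, h1, h2, h3⟩ := exists_scale_norm_sub_rpow_le hp hpq X (hτ i.le_succ)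
      ((hτ i.zero_le).trans hT) hne
    refine (ENNReal.ofReal_le_ofReal h3).trans ?_
    rw [ENNReal.ofReal_mul hc0]
    gcongr
    rw [ENNReal.ofReal_mul (by positivity)]
    have h4 : F m u ≤ ∑ u ∈ Ico (τ (i + 1)) (τ i), F m u :=
      single_le_sum (f := F m) (fun _ _ => zero_le) (mem_Ico.2 ⟨h1, h2⟩)
    calc w m * F m u ≤ w m * ∑ u ∈ Ico (τ (i + 1)) (τ i), F m u := by gcongr
      _ ≤ _ := ENNReal.le_tsum (f := fun m => w m * ∑ u ∈ Ico (τ (i + 1)) (τ i), F m u) m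
  calc _ ≤ ∑ i ∈ range m, ENNReal.ofReal c * ∑' m, w m * ∑ u ∈ Ico (τ (i + 1)) (τ i), F m u :=
        sum_le_sum fun i _ => hone i
    _ = ENNReal.ofReal c * ∑' m', w m' *
        ∑ i ∈ range m, ∑ u ∈ Ico (τ (i + 1)) (τ i), F m' u := by
        rw [← mul_sum, ← Summable.tsum_finsetSum fun _ _ => ENNReal.summable]
        simp only [mul_sum]
    _ ≤ _ := by
        unfold anchorSum
        gcongr with m'
        rw [sum_Ico_antitone (F m') hτ]
        refine sum_le_sum_of_subset fun u hu => ?_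
        rw [mem_Ico] at hu
        exact mem_range.2 (by omega)

end Variation

theorem tsum_anchorSum_le {B : Type*} [NormedAddCommGroup B] [NormedSpace ℝ B] {p q δ : ℝ}
    (hB : UniformlyAboveTangents B p δ) (hδ : 0 < δ) (N : ℕ) (f : ℤ → B) :
    ∑' x, anchorSum p q (dyadicPath N f x) N ≤
      (∑' m : ℕ, ENNReal.ofReal (((1 / 2 : ℝ) ^ (m + 1)) ^ (q - p))) *
        (ENNReal.ofReal δ⁻¹ * ∑' x, ENNReal.ofReal (‖f x‖ ^ p)) := by
  unfold anchorSum
  rw [ENNReal.tsum_comm, ← ENNReal.tsum_mul_right]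
  refine ENNReal.tsum_le_tsum fun m => ?_
  rw [ENNReal.tsum_mul_left]
  gcongr
  rw [ENNReal.ofReal_inv_of_pos hδ, mul_comm, ← div_eq_mul_inv,
    ENNReal.le_div_iff_mul_le (Or.inl (by simpa using hδ)) (Or.inl ENNReal.ofReal_ne_top),
    mul_comm, ← ENNReal.tsum_mul_left]
  refine le_trans ?_ (tsum_anchor_le hB hδ ((1 / 2) ^ (m + 1)) N f)
  exact ENNReal.tsum_le_tsum fun x => le_add_self

theorem tsum_scale_weight_ne_top {r : ℝ} (hr : 0 < r) :
    ∑' m : ℕ, ENNReal.ofReal (((1 / 2 : ℝ) ^ (m + 1)) ^ r) ≠ ⊤ := by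
  have h : ∀ m : ℕ, ((1 / 2 : ℝ) ^ (m + 1)) ^ r = ((1 / 2 : ℝ) ^ r) ^ (m + 1) := by
    intro m
    rw [← Real.rpow_natCast, ← Real.rpow_mul (by norm_num), mul_comm,
      Real.rpow_mul (by norm_num), Real.rpow_natCast]
  have h1 : (1 / 2 : ℝ) ^ r < 1 := Real.rpow_lt_one (by norm_num) (by norm_num) hr
  have hs : Summable fun m : ℕ => ((1 / 2 : ℝ) ^ r) ^ (m + 1) :=
    (_root_.summable_nat_add_iff 1).2 (summable_geometric_of_lt_one (by positivity) h1)
  simp only [h]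
  rw [← ENNReal.ofReal_tsum_of_nonneg (fun m => by positivity) hs]
  exact ENNReal.ofReal_ne_top

/-! ### `ℓ^p` estimates for the shift averages of dyadic pieces -/

section PowSum

variable {B : Type*} [NormedAddCommGroup B]

/-- The `p`-th power of the `ℓ^p` norm. -/
noncomputable def powSum (p : ℝ) (g : ℤ → B) : ℝ≥0∞ :=
  ∑' x, ENNReal.ofReal (‖g x‖ ^ p)

theorem powSum_add_le {p : ℝ} (hp : 0 ≤ p) (g h : ℤ → B) :
    powSum p (fun x => g x + h x) ≤ ENNReal.ofReal (2 ^ p) * (powSum p g + powSum p h) := by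
  unfold powSum
  rw [← ENNReal.tsum_add, ← ENNReal.tsum_mul_left]
  refine ENNReal.tsum_le_tsum fun x => ?_
  rw [← ENNReal.ofReal_add (by positivity) (by positivity), ← ENNReal.ofReal_mul (by positivity)]
  refine ENNReal.ofReal_le_ofReal ?_
  exact (Real.rpow_le_rpow (norm_nonneg _) (norm_add_le _ _) hp).trans
    (add_rpow_le_two_rpow_mul hp (norm_nonneg _) (norm_nonneg _))

theorem powSum_neg (p : ℝ) (g : ℤ → B) : powSum p (fun x => -g x) = powSum p g := by
  simp [powSum]

theorem powSum_sub_le {p : ℝ} (hp : 0 ≤ p) (g h : ℤ → B) :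
    powSum p (fun x => g x - h x) ≤ ENNReal.ofReal (2 ^ p) * (powSum p g + powSum p h) := by
  have := powSum_add_le hp g (fun x => -h x)
  rw [powSum_neg] at this
  simpa only [sub_eq_add_neg] using this

theorem powSum_shift (p : ℝ) (g : ℤ → B) (i : ℤ) : powSum p (fun x => g (x + i)) = powSum p g :=
  (Equiv.addRight i).tsum_eq fun x => ENNReal.ofReal (‖g x‖ ^ p)

theorem powSum_shift_sub_le {p : ℝ} (hp : 0 ≤ p) (g : ℤ → B) (i : ℤ) :
    powSum p (fun x => g (x + i) - g x) ≤ ENNReal.ofReal (2 ^ (p + 1)) * powSum p g := by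
  refine (powSum_sub_le hp _ _).trans_eq ?_
  rw [powSum_shift, ← two_mul, ← mul_assoc]
  congr 1
  rw [Real.rpow_add_one (by norm_num), ENNReal.ofReal_mul (by positivity)]
  simp

/-- A function constant on blocks of length `L` is moved little by short shifts. -/
theorem BlockConst.powSum_shift_sub_le {p : ℝ} (hp : 0 < p) {L : ℕ} (hL : 0 < L) {g : ℤ → B}
    (hg : BlockConst L g) (i : ℕ) :
    powSum p (fun x => g (x + i) - g x)
      ≤ ENNReal.ofReal (2 ^ (p + 1) * (i / L)) * powSum p g := by
  rcases le_or_gt L i with hi | hi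
  · refine (_root_.powSum_shift_sub_le hp.le g i).trans ?_
    gcongr
    refine le_mul_of_one_le_right (by positivity) ?_
    rw [one_le_div (by exact_mod_cast hL)]
    exact_mod_cast hi
  set G : ℤ → ℝ≥0∞ := fun a => ENNReal.ofReal (‖g (L * a)‖ ^ p) with hG
  have hD : powSum p g = ENNReal.ofReal L * ∑' a, G a := by
    unfold powSum
    rw [tsum_eq_tsum_blockSum hL (fun x => ENNReal.ofReal (‖g x‖ ^ p)), ← ENNReal.tsum_mul_left]
    refine tsum_congr fun a => ?_
    have h : ∀ r ∈ range L, ENNReal.ofReal (‖g (L * a + r)‖ ^ p) = G a := fun r hr => by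
      rw [hg.apply_mul_add a (mem_range.1 hr)]
    rw [blockSum, sum_congr rfl h]
    simp
  have hshift : ∑' a, G (a + 1) = ∑' a, G a := (Equiv.addRight (1 : ℤ)).tsum_eq G
  have hterm : ∀ (a : ℤ), ∀ r ∈ range L,
      ENNReal.ofReal (‖g (L * a + r + i) - g (L * a + r)‖ ^ p)
        ≤ if L - i ≤ r then ENNReal.ofReal (2 ^ p) * (G (a + 1) + G a) else 0 := by
    intro a r hr
    rw [mem_range] at hr
    split_ifs with hri
    · have e : (L : ℤ) * a + r + i = L * (a + 1) + (r + i - L : ℕ) := by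
        push_cast [Nat.cast_sub (by omega : L ≤ r + i)]
        ring
      rw [e, hg.apply_mul_add a hr, hg.apply_mul_add (a + 1) (by omega), hG]
      beta_reduce
      rw [← ENNReal.ofReal_add (by positivity) (by positivity),
        ← ENNReal.ofReal_mul (by positivity)]
      refine ENNReal.ofReal_le_ofReal ?_
      exact (Real.rpow_le_rpow (norm_nonneg _) (norm_sub_le _ _) hp.le).trans
        (add_rpow_le_two_rpow_mul hp.le (norm_nonneg _) (norm_nonneg _))
    · have e : (L : ℤ) * a + r + i = L * a + (r + i : ℕ) := by push_cast; ring
      rw [e, hg.apply_mul_add a hr, hg.apply_mul_add a (by omega), sub_self, norm_zero,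
        Real.zero_rpow hp.ne', ENNReal.ofReal_zero]
  have hblock : ∀ a, blockSum L (fun x => ENNReal.ofReal (‖g (x + i) - g x‖ ^ p)) a
      ≤ ENNReal.ofReal i * (ENNReal.ofReal (2 ^ p) * (G (a + 1) + G a)) := by
    intro a
    refine (sum_le_sum (hterm a)).trans ?_
    rw [← sum_filter, sum_const, nsmul_eq_mul]
    have hcard : #{r ∈ range L | L - i ≤ r} ≤ i := by
      refine (card_le_card (t := Ico (L - i) L) fun r hr => ?_).trans ?_
      · rw [mem_filter, mem_range] at hr
        exact mem_Ico.2 ⟨hr.2, hr.1⟩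
      · rw [Nat.card_Ico]; omega
    gcongr
    rw [ENNReal.ofReal_natCast]
    exact_mod_cast hcard
  calc powSum p (fun x => g (x + i) - g x)
      = ∑' a, blockSum L (fun x => ENNReal.ofReal (‖g (x + i) - g x‖ ^ p)) a :=
        tsum_eq_tsum_blockSum hL _
    _ ≤ ∑' a, ENNReal.ofReal i * (ENNReal.ofReal (2 ^ p) * (G (a + 1) + G a)) :=
        ENNReal.tsum_le_tsum hblock
    _ = ENNReal.ofReal i * (ENNReal.ofReal (2 ^ p) * (2 * ∑' a, G a)) := by
        rw [ENNReal.tsum_mul_left, ENNReal.tsum_mul_left, ENNReal.tsum_add, hshift, two_mul]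
    _ = ENNReal.ofReal (2 ^ (p + 1) * (i / L)) * powSum p g := by
        have hL' : (0 : ℝ) < L := by exact_mod_cast hL
        have e2 : (2 : ℝ≥0∞) = ENNReal.ofReal 2 := by simp
        rw [hD, e2]
        simp only [← mul_assoc]
        rw [← ENNReal.ofReal_mul (by positivity), ← ENNReal.ofReal_mul (by positivity),
          ← ENNReal.ofReal_mul (by positivity), Real.rpow_add_one (by norm_num)]
        congr 2
        field_simp

theorem norm_sum_rpow_le {ι : Type*} {p : ℝ} (hp : 1 ≤ p) (s : Finset ι) (v : ι → B) :
    ‖∑ i ∈ s, v i‖ ^ p ≤ (#s : ℝ) ^ (p - 1) * ∑ i ∈ s, ‖v i‖ ^ p :=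
  (Real.rpow_le_rpow (norm_nonneg _) (norm_sum_le _ _) (by linarith)).trans
    (Real.rpow_sum_le_const_mul_sum_rpow_of_nonneg s hp fun _ _ => norm_nonneg _)

/-- The sum of `g` over the part of the block of length `M` around `y` that precedes `y`. -/
noncomputable def partialBlockSum (M : ℕ) (g : ℤ → B) (y : ℤ) : B :=
  ∑ i ∈ range (y % M).toNat, g (M * (y / M) + i)

theorem partialBlockSum_mul_add_of_lt {M r : ℕ} (g : ℤ → B) (a : ℤ) (hr : r < M) :
    partialBlockSum M g (M * a + r) = ∑ i ∈ range r, g (M * a + i) := by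
  have h : ((M : ℤ) * a + r) % M = r := by
    rw [Int.mul_add_emod_self_left]
    exact Int.emod_eq_of_lt (by omega) (by omega)
  rw [partialBlockSum, h, mul_add_ediv_of_lt a hr, Int.toNat_natCast]

theorem partialBlockSum_mul_add {M r : ℕ} (hM : 0 < M) {g : ℤ → B} (hg : ∀ a, blockSum M g a = 0)
    (a : ℤ) (hr : r ≤ M) : partialBlockSum M g (M * a + r) = ∑ i ∈ range r, g (M * a + i) := by
  rcases hr.lt_or_eq with hr | rfl
  · exact partialBlockSum_mul_add_of_lt g a hr
  · have e : (r : ℤ) * a + r = r * (a + 1) + (0 : ℕ) := by push_cast; ring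
    rw [e, partialBlockSum_mul_add_of_lt g (a + 1) hM]
    have h := hg a
    rw [blockSum] at h
    rw [h]
    simp

theorem sum_range_eq_partialBlockSum_sub {M : ℕ} (hM : 0 < M) {g : ℤ → B}
    (hg : ∀ a, blockSum M g a = 0) (n : ℕ) (x : ℤ) :
    ∑ i ∈ range n, g (x + i) = partialBlockSum M g (x + n) - partialBlockSum M g x := by
  have hstep : ∀ y, partialBlockSum M g (y + 1) = partialBlockSum M g y + g y := by
    intro y
    have hM' : (0 : ℤ) < M := by exact_mod_cast hM
    have h0 := Int.emod_nonneg y hM'.ne'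
    have h1 := Int.emod_lt_of_pos y hM'
    obtain ⟨r, hr⟩ := Int.eq_ofNat_of_zero_le h0
    have hy : y = M * (y / M) + r := by rw [← hr]; exact (Int.mul_ediv_add_emod y M).symm
    set a := y / M
    have hrM : r < M := by omega
    have e : (M : ℤ) * a + r + 1 = M * a + (r + 1 : ℕ) := by push_cast; ring
    rw [hy, e, partialBlockSum_mul_add hM hg a hrM, partialBlockSum_mul_add hM hg a hrM.le,
      sum_range_succ]
  induction n with
  | zero => simp
  | succ n ih =>
    have e : x + (n + 1 : ℕ) = x + n + 1 := by push_cast; ring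
    rw [sum_range_succ, ih, e, hstep]
    abel

theorem powSum_partialBlockSum_le {p : ℝ} (hp : 1 ≤ p) {M : ℕ} (hM : 0 < M) (g : ℤ → B) :
    powSum p (partialBlockSum M g) ≤ ENNReal.ofReal ((M : ℝ) ^ p) * powSum p g := by
  have hM' : (0 : ℝ) < M := by exact_mod_cast hM
  have hblock : ∀ a, blockSum M (fun x => ‖partialBlockSum M g x‖ ^ p) a
      ≤ blockSum M (fun x => (M : ℝ) ^ p * ‖g x‖ ^ p) a := by
    intro a
    have hterm : ∀ r ∈ range M, ‖partialBlockSum M g (M * a + r)‖ ^ p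
        ≤ (M : ℝ) ^ (p - 1) * blockSum M (fun x => ‖g x‖ ^ p) a := by
      intro r hr
      have hr' := mem_range.1 hr
      rw [partialBlockSum_mul_add_of_lt g a hr']
      refine (norm_sum_rpow_le hp _ _).trans ?_
      rw [card_range]
      have h1 : (r : ℝ) ^ (p - 1) ≤ (M : ℝ) ^ (p - 1) :=
        Real.rpow_le_rpow (by positivity) (by exact_mod_cast hr'.le) (by linarith)
      have h2 : ∑ i ∈ range r, ‖g (M * a + i)‖ ^ p ≤ blockSum M (fun x => ‖g x‖ ^ p) a :=
        sum_le_sum_of_subset_of_nonneg (range_subset_range.2 hr'.le)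
          fun _ _ _ => by positivity
      gcongr
    refine (sum_le_sum hterm).trans_eq ?_
    rw [sum_const, card_range, nsmul_eq_mul, blockSum_mul_left, Real.rpow_sub_one hM'.ne']
    field_simp
  refine (tsum_ofReal_le_of_blockSum_le hM (fun x => by positivity) (fun x => by positivity)
    hblock).trans_eq ?_
  unfold powSum
  rw [← ENNReal.tsum_mul_left]
  exact tsum_congr fun x => ENNReal.ofReal_mul (by positivity)

variable [NormedSpace ℝ B]

theorem powSum_smul (p c : ℝ) (g : ℤ → B) :
    powSum p (fun x => c • g x) = ENNReal.ofReal (|c| ^ p) * powSum p g := by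
  unfold powSum
  rw [← ENNReal.tsum_mul_left]
  refine tsum_congr fun x => ?_
  rw [norm_smul, Real.norm_eq_abs, Real.mul_rpow (abs_nonneg c) (norm_nonneg _),
    ENNReal.ofReal_mul (by positivity)]

theorem powSum_average_le {p : ℝ} (hp : 1 ≤ p) {n : ℕ} (hn : 0 < n) (g : ℕ → ℤ → B)
    {C : ℝ≥0∞} (hC : ∀ i < n, powSum p (g i) ≤ C) :
    powSum p (fun x => (n : ℝ)⁻¹ • ∑ i ∈ range n, g i x) ≤ C := by
  have hn' : (0 : ℝ) < n := by exact_mod_cast hn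
  have hpt : ∀ x, ENNReal.ofReal (‖(n : ℝ)⁻¹ • ∑ i ∈ range n, g i x‖ ^ p)
      ≤ ENNReal.ofReal (n : ℝ)⁻¹ * ∑ i ∈ range n, ENNReal.ofReal (‖g i x‖ ^ p) := by
    intro x
    rw [← ENNReal.ofReal_sum_of_nonneg fun _ _ => by positivity,
      ← ENNReal.ofReal_mul (by positivity)]
    refine ENNReal.ofReal_le_ofReal ?_
    rw [norm_smul, norm_inv, Real.norm_of_nonneg hn'.le, Real.mul_rpow (by positivity)
      (norm_nonneg _)]
    have h := norm_sum_rpow_le hp (range n) (fun i => g i x)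
    rw [card_range] at h
    calc (n : ℝ)⁻¹ ^ p * ‖∑ i ∈ range n, g i x‖ ^ p
        ≤ (n : ℝ)⁻¹ ^ p * ((n : ℝ) ^ (p - 1) * ∑ i ∈ range n, ‖g i x‖ ^ p) := by gcongr
      _ = _ := by
        rw [← mul_assoc, Real.inv_rpow hn'.le, Real.rpow_sub_one hn'.ne']
        field_simp
  calc _ ≤ ∑' x, ENNReal.ofReal (n : ℝ)⁻¹ * ∑ i ∈ range n, ENNReal.ofReal (‖g i x‖ ^ p) :=
        ENNReal.tsum_le_tsum hpt
    _ = ENNReal.ofReal (n : ℝ)⁻¹ * ∑ i ∈ range n, powSum p (g i) := by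
        rw [ENNReal.tsum_mul_left, Summable.tsum_finsetSum fun _ _ => ENNReal.summable]
        rfl
    _ ≤ ENNReal.ofReal (n : ℝ)⁻¹ * ∑ i ∈ range n, C := by
        gcongr with i hi
        exact hC i (mem_range.1 hi)
    _ = C := by
        rw [sum_const, card_range, nsmul_eq_mul, ← mul_assoc, ← ENNReal.ofReal_natCast,
          ← ENNReal.ofReal_mul (by positivity), inv_mul_cancel₀ hn'.ne', ENNReal.ofReal_one, one_mul]

theorem powSum_shiftAvg_le {p : ℝ} (hp : 1 ≤ p) {n : ℕ} (hn : 0 < n) (g : ℤ → B) :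
    powSum p (shiftAvg n g) ≤ powSum p g :=
  powSum_average_le hp hn (fun i x => g (x + i)) fun i _ => (powSum_shift p g i).le

theorem shiftAvg_sub_self {n : ℕ} (hn : 0 < n) (g : ℤ → B) (x : ℤ) :
    shiftAvg n g x - g x = (n : ℝ)⁻¹ • ∑ i ∈ range n, (g (x + i) - g x) := by
  have hn' : (n : ℝ) ≠ 0 := by exact_mod_cast hn.ne'
  rw [sum_sub_distrib, sum_const, card_range, smul_sub, ← Nat.cast_smul_eq_nsmul ℝ, smul_smul,
    inv_mul_cancel₀ hn', one_smul, shiftAvg]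

theorem shiftAvg_succ_sub {n : ℕ} (hn : 0 < n) (g : ℤ → B) (x : ℤ) :
    shiftAvg (n + 1) g x - shiftAvg n g x
      = ((n + 1 : ℕ) : ℝ)⁻¹ • (g (x + n) - shiftAvg n g x) := by
  have hn' : (n : ℝ) ≠ 0 := by exact_mod_cast hn.ne'
  have hn1 : (n : ℝ) + 1 ≠ 0 := by positivity
  unfold shiftAvg
  rw [sum_range_succ]
  push_cast
  match_scalars <;> field_simp
  ring

theorem BlockConst.powSum_shiftAvg_sub_le {p : ℝ} (hp : 1 ≤ p) {L n : ℕ} (hL : 0 < L) (hn : 0 < n)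
    {g : ℤ → B} (hg : BlockConst L g) :
    powSum p (fun x => shiftAvg n g x - g x)
      ≤ ENNReal.ofReal (2 ^ (p + 1) * (n / L)) * powSum p g := by
  simp only [shiftAvg_sub_self hn]
  refine powSum_average_le hp hn (fun i x => g (x + i) - g x) fun i hi => ?_
  refine (hg.powSum_shift_sub_le (by linarith) hL i).trans ?_
  gcongr

theorem powSum_shiftAvg_succ_sub_le {p : ℝ} (hp : 1 ≤ p) {n : ℕ} (hn : 0 < n) (g : ℤ → B) :
    powSum p (fun x => shiftAvg (n + 1) g x - shiftAvg n g x)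
      ≤ ENNReal.ofReal (2 ^ (p + 1) * (n : ℝ)⁻¹ ^ p) * powSum p g := by
  have hn' : (0 : ℝ) < n := by exact_mod_cast hn
  simp only [shiftAvg_succ_sub hn]
  rw [powSum_smul, abs_of_nonneg (by positivity)]
  have h1 : powSum p (fun x => g (x + n) - shiftAvg n g x)
      ≤ ENNReal.ofReal (2 ^ p) * (powSum p g + powSum p g) := by
    refine (powSum_sub_le (by linarith) _ _).trans ?_
    rw [powSum_shift]
    gcongr
    exact powSum_shiftAvg_le hp hn g
  calc _ ≤ ENNReal.ofReal ((n : ℝ)⁻¹ ^ p) *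
        (ENNReal.ofReal (2 ^ p) * (powSum p g + powSum p g)) := by
        gcongr
        linarith
    _ = _ := by
        have e2 : (2 : ℝ≥0∞) = ENNReal.ofReal 2 := by simp
        rw [← two_mul, e2]
        simp only [← mul_assoc]
        rw [← ENNReal.ofReal_mul (by positivity), ← ENNReal.ofReal_mul (by positivity),
          Real.rpow_add_one (by norm_num)]
        congr 2
        ring

theorem BlockConst.powSum_shiftAvg_succ_sub_le {p : ℝ} (hp : 1 ≤ p) {L n : ℕ} (hL : 0 < L)
    (hn : 0 < n) {g : ℤ → B} (hg : BlockConst L g) :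
    powSum p (fun x => shiftAvg (n + 1) g x - shiftAvg n g x)
      ≤ ENNReal.ofReal (2 ^ (2 * p + 2) * (n : ℝ)⁻¹ ^ p * (n / L)) * powSum p g := by
  have hn' : (0 : ℝ) < n := by exact_mod_cast hn
  have e : ∀ x, shiftAvg (n + 1) g x - shiftAvg n g x
      = ((n + 1 : ℕ) : ℝ)⁻¹ • ((g (x + n) - g x) - (shiftAvg n g x - g x)) := by
    intro x
    rw [shiftAvg_succ_sub hn]
    congr 1
    abel
  simp only [e]
  rw [powSum_smul, abs_of_nonneg (by positivity)]
  set c := ENNReal.ofReal (2 ^ (p + 1) * (n / L)) * powSum p g with hc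
  have h1 : powSum p (fun x => (g (x + n) - g x) - (shiftAvg n g x - g x))
      ≤ ENNReal.ofReal (2 ^ p) * (c + c) := by
    refine (powSum_sub_le (by linarith) _ _).trans ?_
    gcongr
    · exact hg.powSum_shift_sub_le (by linarith) hL n
    · exact hg.powSum_shiftAvg_sub_le hp hL hn
  calc _ ≤ ENNReal.ofReal ((n : ℝ)⁻¹ ^ p) * (ENNReal.ofReal (2 ^ p) * (c + c)) := by
        gcongr
        linarith
    _ = _ := by
        have e2 : (2 : ℝ≥0∞) = ENNReal.ofReal 2 := by simp
        rw [← two_mul, e2, hc]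
        simp only [← mul_assoc]
        rw [← ENNReal.ofReal_mul (by positivity), ← ENNReal.ofReal_mul (by positivity),
          ← ENNReal.ofReal_mul (by positivity)]
        congr 2
        have e3 : (2 : ℝ) ^ (2 * p + 2) = 2 ^ p * 2 * 2 ^ (p + 1) := by
          rw [← Real.rpow_add_one (by norm_num), ← Real.rpow_add (by norm_num)]
          congr 1
          ring
        rw [e3]
        ring

/-- Long averages of a function whose sum over each block of length `M` vanishes are small. -/
theorem powSum_shiftAvg_le_of_blockSum_eq_zero {p : ℝ} (hp : 1 ≤ p) {M : ℕ} (hM : 0 < M)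
    {g : ℤ → B} (hg : ∀ a, blockSum M g a = 0) (n : ℕ) :
    powSum p (shiftAvg n g) ≤ ENNReal.ofReal (2 ^ (p + 1) * ((n : ℝ)⁻¹ * M) ^ p) * powSum p g := by
  have e : shiftAvg n g = fun x => (n : ℝ)⁻¹ •
      (partialBlockSum M g (x + n) - partialBlockSum M g x) := by
    funext x
    rw [shiftAvg, sum_range_eq_partialBlockSum_sub hM hg]
  rw [e, powSum_smul, abs_of_nonneg (by positivity)]
  calc _ ≤ ENNReal.ofReal ((n : ℝ)⁻¹ ^ p) * (ENNReal.ofReal (2 ^ (p + 1)) *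
        (ENNReal.ofReal ((M : ℝ) ^ p) * powSum p g)) := by
        gcongr
        refine (_root_.powSum_shift_sub_le (by linarith) _ _).trans ?_
        gcongr
        exact powSum_partialBlockSum_le hp hM g
    _ = _ := by
        simp only [← mul_assoc]
        rw [← ENNReal.ofReal_mul (by positivity), ← ENNReal.ofReal_mul (by positivity),
          Real.mul_rpow (by positivity) (by positivity)]
        congr 2
        ring

end PowSum

/-! ### Discrete Sobolev inequalities -/

section Sobolev

variable {B : Type*} [NormedAddCommGroup B]

theorem norm_sub_rpow_le_sum {p : ℝ} (hp : 1 ≤ p) (u : ℕ → B) {a b v w : ℕ}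
    (hav : a ≤ v) (hvb : v ≤ b) (haw : a ≤ w) (hwb : w ≤ b) :
    ‖u v - u w‖ ^ p ≤ ((b - a : ℕ) : ℝ) ^ (p - 1) * ∑ i ∈ Ico a b, ‖u (i + 1) - u i‖ ^ p := by
  wlog h : w ≤ v generalizing v w
  · rw [norm_sub_rev]
    exact this haw hwb hav hvb (by omega)
  rw [← sum_Ico_sub u h]
  refine (norm_sum_rpow_le hp _ _).trans ?_
  have h1 : (#(Ico w v) : ℝ) ≤ (b - a : ℕ) := by
    rw [Nat.card_Ico]
    exact_mod_cast (by omega : v - w ≤ b - a)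
  have h2 : ∑ i ∈ Ico w v, ‖u (i + 1) - u i‖ ^ p ≤ ∑ i ∈ Ico a b, ‖u (i + 1) - u i‖ ^ p :=
    sum_le_sum_of_subset_of_nonneg (Ico_subset_Ico haw hvb) fun _ _ _ => by positivity
  have h3 := Real.rpow_le_rpow (by positivity) h1 (by linarith : 0 ≤ p - 1)
  gcongr

/-- The energy at time `i` of a sequence varying on the time scale `L`. -/
noncomputable def energy (p : ℝ) (L : ℕ) (u : ℕ → B) (i : ℕ) : ℝ :=
  (L : ℝ)⁻¹ * ‖u i‖ ^ p + (L : ℝ) ^ (p - 1) * ‖u (i + 1) - u i‖ ^ p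

theorem energy_nonneg (p : ℝ) (L : ℕ) (u : ℕ → B) (i : ℕ) : 0 ≤ energy p L u i := by
  unfold energy
  positivity

theorem norm_rpow_le_sum_energy {p : ℝ} (hp : 1 ≤ p) {L : ℕ} (hL : 0 < L) (u : ℕ → B) {n v : ℕ}
    (hnv : n ≤ v) (hv : v ≤ n + L) :
    ‖u v‖ ^ p ≤ 2 ^ p * ∑ i ∈ Ico n (n + L), energy p L u i := by
  have hL' : (0 : ℝ) < L := by exact_mod_cast hL
  set D := ∑ i ∈ Ico n (n + L), ‖u (i + 1) - u i‖ ^ p with hD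
  have hterm : ∀ i ∈ Ico n (n + L), ‖u v‖ ^ p
      ≤ 2 ^ p * (‖u i‖ ^ p + (L : ℝ) ^ (p - 1) * D) := by
    intro i hi
    rw [mem_Ico] at hi
    have h1 := norm_sub_rpow_le_sum hp u hnv hv hi.1 hi.2.le
    rw [Nat.add_sub_cancel_left] at h1
    have h2 : ‖u v‖ ≤ ‖u i‖ + ‖u v - u i‖ := by
      have := norm_add_le (u i) (u v - u i)
      rwa [add_sub_cancel] at this
    calc ‖u v‖ ^ p ≤ (‖u i‖ + ‖u v - u i‖) ^ p :=
          Real.rpow_le_rpow (norm_nonneg _) h2 (by linarith)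
      _ ≤ 2 ^ p * (‖u i‖ ^ p + ‖u v - u i‖ ^ p) :=
          add_rpow_le_two_rpow_mul (by linarith) (norm_nonneg _) (norm_nonneg _)
      _ ≤ _ := by gcongr
  have hsum := sum_le_sum hterm
  rw [sum_const, Nat.card_Ico, Nat.add_sub_cancel_left, nsmul_eq_mul, ← mul_sum,
    sum_add_distrib, sum_const, Nat.card_Ico, Nat.add_sub_cancel_left, nsmul_eq_mul] at hsum
  have e : ∑ i ∈ Ico n (n + L), energy p L u i
      = (L : ℝ)⁻¹ * (∑ i ∈ Ico n (n + L), ‖u i‖ ^ p + L * ((L : ℝ) ^ (p - 1) * D)) := by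
    simp only [energy]
    rw [sum_add_distrib, ← mul_sum, ← mul_sum, mul_add, ← mul_assoc (L : ℝ)⁻¹ (L : ℝ),
      inv_mul_cancel₀ hL'.ne', one_mul]
  rw [e, mul_left_comm, ← div_eq_inv_mul, le_div_iff₀ hL', mul_comm]
  exact hsum

theorem norm_sub_rpow_le_sum_energy {p : ℝ} (hp : 1 ≤ p) {L : ℕ} (hL : 0 < L) (u : ℕ → B)
    {n n' : ℕ} (hn : n ≤ n') :
    ‖u n' - u n‖ ^ p ≤ 2 ^ (2 * p + 1) * ∑ i ∈ Ico n n', energy p L u i := by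
  have hE : ∀ i, 0 ≤ energy p L u i := energy_nonneg p L u
  have hS : 0 ≤ ∑ i ∈ Ico n n', energy p L u i := sum_nonneg fun i _ => hE i
  have e2 : (2 : ℝ) ^ (2 * p + 1) = 2 * (2 ^ p * 2 ^ p) := by
    rw [Real.rpow_add_one (by norm_num), ← Real.rpow_add (by norm_num), mul_comm]
    ring_nf
  rcases le_or_gt n' (n + L) with h | h
  · refine (norm_sub_rpow_le_sum hp u hn le_rfl le_rfl hn).trans ?_
    have h1 : ((n' - n : ℕ) : ℝ) ^ (p - 1) ≤ (L : ℝ) ^ (p - 1) :=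
      Real.rpow_le_rpow (by positivity) (by exact_mod_cast (by omega : n' - n ≤ L)) (by linarith)
    have h2 : (1 : ℝ) ≤ 2 ^ (2 * p + 1) := Real.one_le_rpow (by norm_num) (by linarith)
    calc _ ≤ (L : ℝ) ^ (p - 1) * ∑ i ∈ Ico n n', ‖u (i + 1) - u i‖ ^ p := by gcongr
      _ ≤ ∑ i ∈ Ico n n', energy p L u i := by
          rw [mul_sum]
          refine sum_le_sum fun i _ => ?_
          unfold energy
          exact le_add_of_nonneg_left (by positivity)
      _ ≤ _ := le_mul_of_one_le_left hS h2
  · have h1 : ‖u n‖ ^ p ≤ 2 ^ p * ∑ i ∈ Ico n n', energy p L u i := by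
      refine (norm_rpow_le_sum_energy hp hL u le_rfl (Nat.le_add_right n L)).trans ?_
      refine mul_le_mul_of_nonneg_left ?_ (by positivity)
      exact sum_le_sum_of_subset_of_nonneg (Ico_subset_Ico le_rfl h.le) fun i _ _ => hE i
    have h2 : ‖u n'‖ ^ p ≤ 2 ^ p * ∑ i ∈ Ico n n', energy p L u i := by
      refine (norm_rpow_le_sum_energy hp hL u (n := n' - L) (by omega) (by omega)).trans ?_
      refine mul_le_mul_of_nonneg_left ?_ (by positivity)
      exact sum_le_sum_of_subset_of_nonneg (Ico_subset_Ico (by omega) (by omega))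
        fun i _ _ => hE i
    calc ‖u n' - u n‖ ^ p ≤ (‖u n'‖ + ‖u n‖) ^ p :=
          Real.rpow_le_rpow (norm_nonneg _) (norm_sub_le _ _) (by linarith)
      _ ≤ 2 ^ p * (‖u n'‖ ^ p + ‖u n‖ ^ p) :=
          add_rpow_le_two_rpow_mul (by linarith) (norm_nonneg _) (norm_nonneg _)
      _ ≤ 2 ^ p * (2 ^ p * ∑ i ∈ Ico n n', energy p L u i
            + 2 ^ p * ∑ i ∈ Ico n n', energy p L u i) := by gcongr
      _ = _ := by rw [e2]; ring

/-- The Hölder inequality with weights, for norms of finite sums. -/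
theorem norm_sum_rpow_le_weighted {ι : Type*} {p : ℝ} (hp : 1 < p) (s : Finset ι) (v : ι → B)
    {w : ι → ℝ} (hw : ∀ i, 0 < w i) :
    ‖∑ i ∈ s, v i‖ ^ p ≤ (∑ i ∈ s, w i) ^ (p - 1) * ∑ i ∈ s, w i ^ (1 - p) * ‖v i‖ ^ p := by
  have hp0 : p ≠ 0 := by linarith
  have h := Real.inner_le_weight_mul_Lp_of_nonneg s hp.le w (fun i => (w i)⁻¹ * ‖v i‖)
    (fun i => (hw i).le) (fun i => mul_nonneg (inv_nonneg.2 (hw i).le) (norm_nonneg _))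
  have e1 : ∀ i, w i * ((w i)⁻¹ * ‖v i‖) = ‖v i‖ := fun i => mul_inv_cancel_left₀ (hw i).ne' _
  have e2 : ∀ i, w i * ((w i)⁻¹ * ‖v i‖) ^ p = w i ^ (1 - p) * ‖v i‖ ^ p := by
    intro i
    rw [Real.mul_rpow (inv_nonneg.2 (hw i).le) (norm_nonneg _), Real.inv_rpow (hw i).le,
      Real.rpow_sub (hw i), Real.rpow_one]
    ring
  simp only [e1, e2] at h
  have hW : 0 ≤ ∑ i ∈ s, w i := sum_nonneg fun i _ => (hw i).le
  have hS : 0 ≤ ∑ i ∈ s, w i ^ (1 - p) * ‖v i‖ ^ p :=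
    sum_nonneg fun i _ => mul_nonneg (Real.rpow_nonneg (hw i).le _) (by positivity)
  refine (Real.rpow_le_rpow (norm_nonneg _) ((norm_sum_le _ _).trans h) (by linarith)).trans_eq ?_
  rw [Real.mul_rpow (Real.rpow_nonneg hW _) (Real.rpow_nonneg hS _), ← Real.rpow_mul hW,
    ← Real.rpow_mul hS]
  congr 2
  · field_simp
  · rw [inv_mul_cancel₀ hp0, Real.rpow_one]

end Sobolev

/-! ### Geometric weights and gluing of dyadic scales -/

/-- The distance between two natural numbers, as a natural number. -/
def scaleDist (j k : ℕ) : ℕ := (j - k) + (k - j)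

theorem scaleDist_comm (j k : ℕ) : scaleDist j k = scaleDist k j := Nat.add_comm _ _

theorem sum_pow_scaleDist_le {r : ℝ} (h0 : 0 ≤ r) (h1 : r < 1) (k M : ℕ) :
    ∑ j ∈ range M, r ^ scaleDist j k ≤ 2 * (1 - r)⁻¹ := by
  have hgeom : ∀ n, ∑ i ∈ range n, r ^ i ≤ (1 - r)⁻¹ := by
    intro n
    rw [← tsum_geometric_of_lt_one h0 h1]
    exact (summable_geometric_of_lt_one h0 h1).sum_le_tsum _ fun i _ => pow_nonneg h0 i
  have hM : range M ⊆ range (k + M) := range_subset_range.2 (Nat.le_add_left M k)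
  calc ∑ j ∈ range M, r ^ scaleDist j k
      ≤ ∑ j ∈ range (k + M), r ^ scaleDist j k :=
        sum_le_sum_of_subset_of_nonneg hM fun _ _ _ => pow_nonneg h0 _
    _ = ∑ j ∈ range k, r ^ scaleDist j k + ∑ i ∈ range M, r ^ i := by
        rw [sum_range_add]
        congr 1
        refine sum_congr rfl fun i _ => ?_
        congr 1
        unfold scaleDist
        omega
    _ ≤ ∑ i ∈ range k, r ^ i + ∑ i ∈ range M, r ^ i := by
        gcongr ?_ + _
        rw [← sum_range_reflect]
        refine sum_le_sum fun i hi => ?_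
        rw [mem_range] at hi
        refine pow_le_pow_of_le_one h0 h1.le ?_
        unfold scaleDist
        omega
    _ ≤ 2 * (1 - r)⁻¹ := by linarith [hgeom k, hgeom M]

theorem sum_Ico_monotone {V : Type*} [AddCommMonoid V] (F : ℕ → V) {τ : ℕ → ℕ} (hτ : Monotone τ)
    (m : ℕ) : ∑ i ∈ range m, ∑ s ∈ Ico (τ i) (τ (i + 1)), F s = ∑ s ∈ Ico (τ 0) (τ m), F s := by
  induction m with
  | zero => simp
  | succ m ih =>
    rw [sum_range_succ, ih, sum_Ico_consecutive F (hτ (Nat.zero_le m)) (hτ (Nat.le_succ m))]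

theorem sum_Ico_log_le (E : ℕ → ℕ → ℝ) (hE : ∀ k i, 0 ≤ E k i) (N : ℕ) :
    ∑ n ∈ Ico 1 (2 ^ N), E (Nat.log 2 n) n
      ≤ ∑ k ∈ range N, ∑ i ∈ Ico (2 ^ k) (2 ^ (k + 2)), E k i := by
  induction N with
  | zero => simp
  | succ N ih =>
    rw [sum_range_succ, ← sum_Ico_consecutive _ Nat.one_le_two_pow
      (Nat.pow_le_pow_right two_pos (Nat.le_succ N))]
    refine add_le_add ih ?_
    have h : ∀ n ∈ Ico (2 ^ N) (2 ^ (N + 1)), E (Nat.log 2 n) n = E N n := by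
      intro n hn
      rw [mem_Ico] at hn
      rw [Nat.log_eq_of_pow_le_of_lt_pow hn.1 hn.2]
    rw [sum_congr rfl h]
    exact sum_le_sum_of_subset_of_nonneg
      (Ico_subset_Ico le_rfl (Nat.pow_le_pow_right two_pos (by omega))) fun i _ _ => hE N i

/-- Gluing the variations at each dyadic scale into a variation across all scales. -/
theorem sum_norm_sub_log_rpow_le {B : Type*} [NormedAddCommGroup B] {p A : ℝ} (hp : 0 ≤ p)
    (hA : 0 ≤ A) (c : ℕ → ℕ → B) (E : ℕ → ℕ → ℝ) (hE : ∀ k i, 0 ≤ E k i)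
    (hshort : ∀ k n n', n ≤ n' → ‖c k n' - c k n‖ ^ p ≤ A * ∑ i ∈ Ico n n', E k i)
    (hlong : ∀ k n, 2 ^ k ≤ n → n < 2 ^ (k + 1) →
      ‖c k n‖ ^ p ≤ A * ∑ i ∈ Ico (2 ^ k) (2 ^ (k + 2)), E k i)
    {t : ℕ → ℕ} (ht : Monotone t) (ht0 : 0 < t 0) {m N : ℕ} (hm : t m < 2 ^ N) :
    ∑ i ∈ range m,
      ‖c (Nat.log 2 (t (i + 1))) (t (i + 1)) - c (Nat.log 2 (t i)) (t i)‖ ^ p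
      ≤ A * (1 + 2 ^ (p + 1)) * ∑ k ∈ range N, ∑ i ∈ Ico (2 ^ k) (2 ^ (k + 2)), E k i := by
  set F : ℕ → ℝ := fun k => ∑ i ∈ Ico (2 ^ k) (2 ^ (k + 2)), E k i with hF
  have hF0 : ∀ k, 0 ≤ F k := fun k => sum_nonneg fun i _ => hE k i
  set κ : ℕ → ℕ := fun i => Nat.log 2 (t i) with hκ
  have hκm : Monotone κ := fun i j hij => Nat.log_mono_right (ht hij)
  have htpos : ∀ i, t i ≠ 0 := fun i => (ht0.trans_le (ht (Nat.zero_le i))).ne'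
  have hlo : ∀ i, 2 ^ κ i ≤ t i := fun i => Nat.pow_log_le_self 2 (htpos i)
  have hhi : ∀ i, t i < 2 ^ (κ i + 1) := fun i => Nat.lt_pow_succ_log_self (by norm_num) _
  have hterm : ∀ i ∈ range m, ‖c (κ (i + 1)) (t (i + 1)) - c (κ i) (t i)‖ ^ p
      ≤ A * ∑ n ∈ Ico (t i) (t (i + 1)), E (Nat.log 2 n) n
        + 2 ^ p * A * (∑ k ∈ Ico (κ i) (κ (i + 1)), F k
          + ∑ k ∈ Ico (κ i + 1) (κ (i + 1) + 1), F k) := by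
    intro i _
    have hsum0 : ∀ a b, 0 ≤ ∑ k ∈ Ico a b, F k := fun a b => sum_nonneg fun k _ => hF0 k
    have hsumE : 0 ≤ ∑ n ∈ Ico (t i) (t (i + 1)), E (Nat.log 2 n) n :=
      sum_nonneg fun n _ => hE _ n
    rcases (hκm (Nat.le_succ i)).eq_or_lt with h | h
    · rw [← h]
      refine (hshort _ _ _ (ht (Nat.le_succ i))).trans ?_
      have e : ∑ n ∈ Ico (t i) (t (i + 1)), E (κ i) n
          = ∑ n ∈ Ico (t i) (t (i + 1)), E (Nat.log 2 n) n := by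
        refine sum_congr rfl fun n hn => ?_
        rw [mem_Ico] at hn
        rw [Nat.log_eq_of_pow_le_of_lt_pow ((hlo i).trans hn.1)]
        exact hn.2.trans (h ▸ hhi (i + 1))
      rw [e]
      refine le_add_of_nonneg_right (mul_nonneg (by positivity) (add_nonneg ?_ ?_)) <;>
        exact hsum0 _ _
    · have h1 : ‖c (κ i) (t i)‖ ^ p ≤ A * ∑ k ∈ Ico (κ i) (κ (i + 1)), F k :=
        (hlong _ _ (hlo i) (hhi i)).trans (mul_le_mul_of_nonneg_left
          (single_le_sum (fun k _ => hF0 k) (mem_Ico.2 ⟨le_rfl, h⟩)) hA)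
      have h2 : ‖c (κ (i + 1)) (t (i + 1))‖ ^ p
          ≤ A * ∑ k ∈ Ico (κ i + 1) (κ (i + 1) + 1), F k :=
        (hlong _ _ (hlo _) (hhi _)).trans (mul_le_mul_of_nonneg_left
          (single_le_sum (f := F) (fun k _ => hF0 k) (mem_Ico.2 ⟨h, Nat.lt_succ_self _⟩)) hA)
      calc ‖c (κ (i + 1)) (t (i + 1)) - c (κ i) (t i)‖ ^ p
          ≤ (‖c (κ (i + 1)) (t (i + 1))‖ + ‖c (κ i) (t i)‖) ^ p :=
            Real.rpow_le_rpow (norm_nonneg _) (norm_sub_le _ _) hp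
        _ ≤ 2 ^ p * (‖c (κ (i + 1)) (t (i + 1))‖ ^ p + ‖c (κ i) (t i)‖ ^ p) :=
            add_rpow_le_two_rpow_mul hp (norm_nonneg _) (norm_nonneg _)
        _ ≤ 2 ^ p * (A * ∑ k ∈ Ico (κ i + 1) (κ (i + 1) + 1), F k
              + A * ∑ k ∈ Ico (κ i) (κ (i + 1)), F k) := by gcongr
        _ = 2 ^ p * A * (∑ k ∈ Ico (κ i) (κ (i + 1)), F k
              + ∑ k ∈ Ico (κ i + 1) (κ (i + 1) + 1), F k) := by ring
        _ ≤ _ := le_add_of_nonneg_left (by positivity)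
  refine (sum_le_sum hterm).trans ?_
  rw [sum_add_distrib, ← mul_sum, ← mul_sum, sum_add_distrib, sum_Ico_monotone _ ht,
    sum_Ico_monotone F hκm,
    sum_Ico_monotone F (τ := fun i => κ i + 1) fun i j hij => Nat.succ_le_succ (hκm hij)]
  have hκN : κ m + 1 ≤ N := Nat.log_lt_of_lt_pow (htpos m) hm
  have hsub : ∀ a b, b ≤ N → ∑ k ∈ Ico a b, F k ≤ ∑ k ∈ range N, F k := fun a b hb =>
    sum_le_sum_of_subset_of_nonneg
      (fun k hk => mem_range.2 ((mem_Ico.1 hk).2.trans_le hb)) fun k _ _ => hF0 k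
  have hE' : ∑ n ∈ Ico (t 0) (t m), E (Nat.log 2 n) n ≤ ∑ k ∈ range N, F k :=
    (sum_le_sum_of_subset_of_nonneg (Ico_subset_Ico ht0 hm.le) fun n _ _ => hE _ n).trans
      (sum_Ico_log_le E hE N)
  calc _ ≤ A * ∑ k ∈ range N, F k + 2 ^ p * A * (∑ k ∈ range N, F k + ∑ k ∈ range N, F k) := by
        have h1 := hsub (κ 0) (κ m) (by omega)
        have h2 := hsub (κ 0 + 1) (κ m + 1) hκN
        gcongr
    _ = _ := by
        rw [Real.rpow_add_one (by norm_num)]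
        ring

/-! ### Comparison of the shift averages with the dyadic averages -/

/-- The ratio of the geometric weights distributing the error among the pieces. -/
noncomputable def weightRatio (p : ℝ) : ℝ := 2 ^ (-(1 / 2) / (p - 1))

theorem weightRatio_pos (p : ℝ) : 0 < weightRatio p := by
  unfold weightRatio
  positivity

theorem weightRatio_lt_one {p : ℝ} (hp : 1 < p) : weightRatio p < 1 :=
  Real.rpow_lt_one_of_one_lt_of_neg (by norm_num) (div_neg_of_neg_of_pos (by norm_num) (by linarith))

theorem weightRatio_pow_rpow {p : ℝ} (hp : 1 < p) (d : ℕ) :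
    (weightRatio p ^ d) ^ (1 - p) = √2 ^ d := by
  have hp' : p - 1 ≠ 0 := by linarith
  have h : weightRatio p ^ (1 - p) = √2 := by
    rw [weightRatio, ← Real.rpow_mul (by norm_num), Real.sqrt_eq_rpow]
    congr 1
    field_simp
    ring
  rw [← h, ← Real.rpow_natCast, ← Real.rpow_natCast, ← Real.rpow_mul (weightRatio_pos p).le,
    ← Real.rpow_mul (weightRatio_pos p).le, mul_comm]

/-- The constant in the pointwise bound of the comparison error. -/
noncomputable def errorConst (p : ℝ) : ℝ :=
  (2 * (1 - weightRatio p)⁻¹) ^ (p - 1) * 2 ^ (2 * p + 1)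

theorem errorConst_nonneg {p : ℝ} (hp : 1 < p) : 0 ≤ errorConst p := by
  have := weightRatio_lt_one hp
  have : 0 ≤ (1 - weightRatio p)⁻¹ := inv_nonneg.2 (by linarith)
  unfold errorConst
  positivity

theorem norm_sum_rpow_le_of_scaleDist {B : Type*} [NormedAddCommGroup B] {p : ℝ} (hp : 1 < p) (k M : ℕ)
    (v : ℕ → B) {S : ℕ → ℝ}
    (hS : ∀ j, ‖v j‖ ^ p ≤ 2 ^ (2 * p + 1) * S j) :
    ‖∑ j ∈ range M, v j‖ ^ p ≤ errorConst p * ∑ j ∈ range M, √2 ^ scaleDist j k * S j := by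
  have hr := weightRatio_pos p
  have hr1 := weightRatio_lt_one hp
  refine (norm_sum_rpow_le_weighted hp (range M) v
    (w := fun j => weightRatio p ^ scaleDist j k) fun j => pow_pos hr _).trans ?_
  simp only [weightRatio_pow_rpow hp]
  have h1 : (∑ j ∈ range M, weightRatio p ^ scaleDist j k) ^ (p - 1)
      ≤ (2 * (1 - weightRatio p)⁻¹) ^ (p - 1) :=
    Real.rpow_le_rpow (sum_nonneg fun j _ => by positivity)
      (sum_pow_scaleDist_le hr.le hr1 k M) (by linarith)
  have h2 : ∑ j ∈ range M, √2 ^ scaleDist j k * ‖v j‖ ^ p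
      ≤ 2 ^ (2 * p + 1) * ∑ j ∈ range M, √2 ^ scaleDist j k * S j := by
    rw [mul_sum]
    refine sum_le_sum fun j _ => ?_
    rw [mul_left_comm]
    exact mul_le_mul_of_nonneg_left (hS j) (by positivity)
  rw [errorConst, mul_assoc]
  exact mul_le_mul h1 h2 (sum_nonneg fun j _ => by positivity)
    (Real.rpow_nonneg (mul_nonneg zero_le_two (inv_nonneg.2 (by linarith))) _)

section Comparison

variable {B : Type*} [NormedAddCommGroup B] [NormedSpace ℝ B]

/-- The pieces of the decomposition
`f = (D_0 f - D_1 f) + … + (D_{N-1} f - D_N f) + D_N f` into dyadic martingale differences. -/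
noncomputable def dyadicPiece (N : ℕ) (f : ℤ → B) (j : ℕ) : ℤ → B :=
  if j < N then fun x => dyadicAvg j f x - dyadicAvg (j + 1) f x else dyadicAvg N f

theorem sum_ite_dyadicPiece {N k : ℕ} (hk : k ≤ N) (f : ℤ → B) (x : ℤ) :
    ∑ j ∈ range (N + 1), (if k ≤ j then dyadicPiece N f j x else 0) = dyadicAvg k f x := by
  have h : ∀ M ≤ N, ∑ j ∈ range M, (if k ≤ j then dyadicPiece N f j x else 0)
      = if k ≤ M then dyadicAvg k f x - dyadicAvg M f x else 0 := by
    intro M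
    induction M with
    | zero =>
      intro _
      rcases Nat.eq_zero_or_pos k with rfl | hk
      · simp
      · simp [hk.ne']
    | succ M ih =>
      intro hM
      rw [sum_range_succ, ih (by omega), dyadicPiece, if_pos (by omega : M < N)]
      rcases lt_trichotomy k (M + 1) with h | h | h
      · rw [if_pos (by omega), if_pos (by omega), if_pos (by omega)]
        abel
      · rw [if_neg (by omega), if_neg (by omega), if_pos (by omega), h]
        abel
      · rw [if_neg (by omega), if_neg (by omega), if_neg (by omega), add_zero]
  rw [sum_range_succ, h N le_rfl, if_pos hk, if_pos hk, dyadicPiece, if_neg (lt_irrefl N)]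
  abel

/-- The contribution of the piece `j` to the difference of an average of length `n` and the
dyadic average of order `k`. -/
noncomputable def pieceError (N : ℕ) (f : ℤ → B) (k j n : ℕ) (x : ℤ) : B :=
  shiftAvg n (dyadicPiece N f j) x - if k ≤ j then dyadicPiece N f j x else 0

theorem sum_pieceError {N k : ℕ} (hk : k ≤ N) (f : ℤ → B) (n : ℕ) (x : ℤ) :
    ∑ j ∈ range (N + 1), pieceError N f k j n x = shiftAvg n f x - dyadicAvg k f x := by
  have hf : ∀ y, ∑ j ∈ range (N + 1), dyadicPiece N f j y = f y := by
    intro y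
    simpa [dyadicAvg_zero] using sum_ite_dyadicPiece (Nat.zero_le N) f y
  unfold pieceError
  rw [sum_sub_distrib, sum_ite_dyadicPiece hk]
  congr 1
  unfold shiftAvg
  rw [← smul_sum, sum_comm]
  simp only [hf]

/-- The total energy of all the piece errors at a point. -/
noncomputable def errorEnergy (p : ℝ) (N : ℕ) (f : ℤ → B) (x : ℤ) : ℝ :=
  ∑ k ∈ range N, ∑ i ∈ Ico (2 ^ k) (2 ^ (k + 2)), ∑ j ∈ range (N + 1),
    √2 ^ scaleDist j k * energy p (2 ^ min j k) (fun n => pieceError N f k j n x) i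

/-- The `p`-variation of the difference between the averages and their dyadic counterparts. -/
theorem sum_norm_error_rpow_le {p : ℝ} (hp : 1 < p) (f : ℤ → B) (x : ℤ) {t : ℕ → ℕ}
    (ht : Monotone t) (ht0 : 0 < t 0) {m N : ℕ} (hm : t m < 2 ^ N) :
    ∑ i ∈ range m,
      ‖(shiftAvg (t (i + 1)) f x - dyadicAvg (Nat.log 2 (t (i + 1))) f x)
        - (shiftAvg (t i) f x - dyadicAvg (Nat.log 2 (t i)) f x)‖ ^ p
      ≤ errorConst p * (1 + 2 ^ (p + 1)) * errorEnergy p N f x := by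
  set E : ℕ → ℕ → ℝ := fun k i => ∑ j ∈ range (N + 1),
    √2 ^ scaleDist j k * energy p (2 ^ min j k) (fun n => pieceError N f k j n x) i with hE
  have hE0 : ∀ k i, 0 ≤ E k i := fun k i =>
    sum_nonneg fun j _ => mul_nonneg (by positivity) (energy_nonneg _ _ _ _)
  have hcomm : ∀ (k a b : ℕ), ∑ j ∈ range (N + 1), √2 ^ scaleDist j k *
      ∑ i ∈ Ico a b, energy p (2 ^ min j k) (fun n => pieceError N f k j n x) i
      = ∑ i ∈ Ico a b, E k i := by
    intro k a b
    rw [hE, sum_comm]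
    exact sum_congr rfl fun j _ => mul_sum _ _ _
  have h := sum_norm_sub_log_rpow_le (by linarith) (errorConst_nonneg hp)
    (fun k n => ∑ j ∈ range (N + 1), pieceError N f k j n x) E hE0 ?_ ?_ ht ht0 hm
  · refine le_of_eq_of_le ?_ h
    have hlog : ∀ i ≤ m, Nat.log 2 (t i) ≤ N := fun i hi =>
      (Nat.log_lt_of_lt_pow (ht0.trans_le (ht (Nat.zero_le i))).ne' ((ht hi).trans_lt hm)).le
    refine sum_congr rfl fun i hi => ?_
    have hi' := mem_range.1 hi
    rw [sum_pieceError (hlog (i + 1) hi'), sum_pieceError (hlog i hi'.le)]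
  · intro k n n' hn
    rw [← hcomm]
    rw [← sum_sub_distrib]
    exact norm_sum_rpow_le_of_scaleDist hp k (N + 1) _ fun j =>
      norm_sub_rpow_le_sum_energy hp.le (pow_pos two_pos _) (fun n => pieceError N f k j n x) hn
  · intro k n hn hn'
    rw [← hcomm]
    refine norm_sum_rpow_le_of_scaleDist hp k (N + 1) _ fun j => ?_
    refine (norm_rpow_le_sum_energy hp.le (pow_pos two_pos (min j k))
      (fun n => pieceError N f k j n x) le_rfl (Nat.le_add_right n _)).trans ?_
    have hL : 2 ^ min j k ≤ 2 ^ k := Nat.pow_le_pow_right two_pos (min_le_right _ _)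
    refine mul_le_mul (Real.rpow_le_rpow_of_exponent_le (by norm_num) (by linarith)) ?_
      (sum_nonneg fun i _ => energy_nonneg _ _ _ _) (by positivity)
    refine sum_le_sum_of_subset_of_nonneg (Ico_subset_Ico hn ?_) fun i _ _ => energy_nonneg _ _ _ _
    rw [pow_succ] at hn'
    rw [pow_succ, pow_succ]
    omega

end Comparison

section ErrorSum

theorem tsum_energy_le {B : Type*} [NormedAddCommGroup B] {p c₁ c₂ c : ℝ} (hc₁ : 0 ≤ c₁)
    (hc₂ : 0 ≤ c₂) {L i : ℕ} (u : ℕ → ℤ → B) {D : ℝ≥0∞}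
    (h₁ : powSum p (u i) ≤ ENNReal.ofReal c₁ * D)
    (h₂ : powSum p (fun x => u (i + 1) x - u i x) ≤ ENNReal.ofReal c₂ * D)
    (hc : (L : ℝ)⁻¹ * c₁ + (L : ℝ) ^ (p - 1) * c₂ ≤ c) :
    ∑' x, ENNReal.ofReal (energy p L (fun n => u n x) i) ≤ ENNReal.ofReal c * D := by
  have e : ∀ x, ENNReal.ofReal (energy p L (fun n => u n x) i)
      = ENNReal.ofReal (L : ℝ)⁻¹ * ENNReal.ofReal (‖u i x‖ ^ p)
        + ENNReal.ofReal ((L : ℝ) ^ (p - 1)) * ENNReal.ofReal (‖u (i + 1) x - u i x‖ ^ p) := by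
    intro x
    rw [energy, ENNReal.ofReal_add (by positivity) (by positivity),
      ENNReal.ofReal_mul (by positivity), ENNReal.ofReal_mul (by positivity)]
  simp only [e]
  rw [ENNReal.tsum_add, ENNReal.tsum_mul_left, ENNReal.tsum_mul_left]
  calc _ ≤ ENNReal.ofReal (L : ℝ)⁻¹ * (ENNReal.ofReal c₁ * D)
        + ENNReal.ofReal ((L : ℝ) ^ (p - 1)) * (ENNReal.ofReal c₂ * D) :=
        add_le_add (mul_le_mul_right h₁ _) (mul_le_mul_right h₂ _)
    _ = ENNReal.ofReal ((L : ℝ)⁻¹ * c₁ + (L : ℝ) ^ (p - 1) * c₂) * D := by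
        rw [← mul_assoc, ← mul_assoc, ← ENNReal.ofReal_mul (by positivity),
          ← ENNReal.ofReal_mul (by positivity), ← add_mul,
          ← ENNReal.ofReal_add (by positivity) (by positivity)]
    _ ≤ _ := by gcongr

variable {B : Type*} [NormedAddCommGroup B] [NormedSpace ℝ B]

theorem blockConst_dyadicPiece {N j : ℕ} (hj : j ≤ N) (f : ℤ → B) :
    BlockConst (2 ^ j) (dyadicPiece N f j) := by
  unfold dyadicPiece
  split_ifs with h
  · intro x y hxy
    have h1 := blockConst_dyadicAvg j f x y hxy
    have h2 := (blockConst_dyadicAvg (j + 1) f).of_two_pow_le (Nat.le_succ j) x y hxy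
    beta_reduce
    rw [h1, h2]
  · exact (blockConst_dyadicAvg N f).of_two_pow_le hj

theorem tsum_energy_pieceError_le_of_lt {p : ℝ} (hp : 2 ≤ p) {N k j i : ℕ} (hk : k < N)
    (hjk : j < k) (hi : 2 ^ k ≤ i) (f : ℤ → B) :
    ∑' x, ENNReal.ofReal (energy p (2 ^ min j k) (fun n => pieceError N f k j n x) i)
      ≤ ENNReal.ofReal (2 ^ (2 * p + 5) * ((2 ^ k)⁻¹ * (1 / 2) ^ scaleDist j k))
        * powSum p (dyadicPiece N f j) := by
  have hi0 : 0 < i := (pow_pos two_pos k).trans_le hi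
  have hmean : ∀ a, blockSum (2 ^ (j + 1)) (dyadicPiece N f j) a = 0 := by
    intro a
    rw [dyadicPiece, if_pos (by omega)]
    exact blockSum_dyadicAvg_sub j f a
  have e : pieceError N f k j = fun n => shiftAvg n (dyadicPiece N f j) := by
    funext n x
    rw [pieceError, if_neg (by omega), sub_zero]
  rw [e]
  refine tsum_energy_le (by positivity) (by positivity)
    (fun n => shiftAvg n (dyadicPiece N f j))
    (powSum_shiftAvg_le_of_blockSum_eq_zero (by linarith) (pow_pos two_pos (j + 1)) hmean i)
    (powSum_shiftAvg_succ_sub_le (by linarith) hi0 _) ?_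
  obtain ⟨d, rfl⟩ := Nat.exists_eq_add_of_le hjk.le
  have hd : scaleDist j (j + d) = d := by unfold scaleDist; omega
  rw [hd, min_eq_left (Nat.le_add_right j d)]
  push_cast
  set A : ℝ := 2 ^ j with hA
  have hT1 : (1 / 2 : ℝ) ^ d ≤ 1 := pow_le_one₀ (by norm_num) (by norm_num)
  have hA0 : 0 < A := by positivity
  have hT0 : (0 : ℝ) < (1 / 2) ^ d := by positivity
  have hiA : (i : ℝ)⁻¹ ≤ A⁻¹ * (1 / 2) ^ d := by
    rw [one_div, inv_pow, ← mul_inv, hA, ← pow_add]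
    exact inv_anti₀ (by positivity) (by exact_mod_cast hi)
  have hkA : ((2 : ℝ) ^ (j + d))⁻¹ = A⁻¹ * (1 / 2) ^ d := by
    rw [one_div, inv_pow, ← mul_inv, hA, ← pow_add]
  rw [hkA, pow_succ, ← hA]
  set T : ℝ := (1 / 2) ^ d
  have hTp : T ^ p ≤ T * T := by
    refine (Real.rpow_le_rpow_of_exponent_ge hT0 hT1 hp).trans_eq ?_
    rw [Real.rpow_two, sq]
  have h1 : A⁻¹ * (2 ^ (p + 1) * ((i : ℝ)⁻¹ * (A * 2)) ^ p)
      ≤ 2 ^ (2 * p + 1) * (A⁻¹ * T * T) := by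
    have h : (i : ℝ)⁻¹ * (A * 2) ≤ 2 * T := by
      calc (i : ℝ)⁻¹ * (A * 2) ≤ A⁻¹ * T * (A * 2) := by gcongr
        _ = 2 * T := by field_simp
    calc _ ≤ A⁻¹ * (2 ^ (p + 1) * (2 * T) ^ p) := by gcongr
      _ = A⁻¹ * (2 ^ (2 * p + 1) * T ^ p) := by
          rw [Real.mul_rpow (by norm_num) hT0.le, ← mul_assoc (2 ^ (p + 1) : ℝ),
            ← Real.rpow_add (by norm_num)]
          ring_nf
      _ ≤ A⁻¹ * (2 ^ (2 * p + 1) * (T * T)) := by gcongr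
      _ = _ := by ring
  have h2 : A ^ (p - 1) * (2 ^ (p + 1) * (i : ℝ)⁻¹ ^ p) ≤ 2 ^ (2 * p + 1) * (A⁻¹ * T * T) := by
    calc _ ≤ A ^ (p - 1) * (2 ^ (p + 1) * (A⁻¹ * T) ^ p) := by gcongr
      _ = 2 ^ (p + 1) * (A⁻¹ * T ^ p) := by
          rw [Real.mul_rpow (by positivity) hT0.le, Real.inv_rpow hA0.le,
            Real.rpow_sub_one hA0.ne']
          field_simp
      _ ≤ 2 ^ (2 * p + 1) * (A⁻¹ * (T * T)) := by
          gcongr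
          · norm_num
          · linarith
      _ = _ := by ring
  have e5 : (2 : ℝ) ^ (2 * p + 5) = 2 ^ (2 * p + 1) * 2 ^ (4 : ℝ) := by
    rw [← Real.rpow_add (by norm_num)]
    ring_nf
  have e4 : (2 : ℝ) ^ (4 : ℝ) = 16 := by norm_num
  have h3 : 0 ≤ (2 : ℝ) ^ (2 * p + 1) * (A⁻¹ * T * T) := by positivity
  rw [e5, e4]
  linarith

theorem tsum_energy_pieceError_le_of_ge {p : ℝ} (hp : 2 ≤ p) {N k j i : ℕ} (hj : j ≤ N)
    (hkj : k ≤ j) (hi : 2 ^ k ≤ i) (hi' : i < 2 ^ (k + 2)) (f : ℤ → B) :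
    ∑' x, ENNReal.ofReal (energy p (2 ^ min j k) (fun n => pieceError N f k j n x) i)
      ≤ ENNReal.ofReal (2 ^ (2 * p + 5) * ((2 ^ k)⁻¹ * (1 / 2) ^ scaleDist j k))
        * powSum p (dyadicPiece N f j) := by
  have hi0 : 0 < i := (pow_pos two_pos k).trans_le hi
  have hconst := blockConst_dyadicPiece hj f
  have e : pieceError N f k j = fun n x => shiftAvg n (dyadicPiece N f j) x - dyadicPiece N f j x := by
    funext n x
    rw [pieceError, if_pos hkj]
  have hsucc := hconst.powSum_shiftAvg_succ_sub_le (by linarith : 1 ≤ p) (pow_pos two_pos j) hi0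
  set g := dyadicPiece N f j
  have e' : ∀ x, shiftAvg (i + 1) g x - shiftAvg i g x
      = (shiftAvg (i + 1) g x - g x) - (shiftAvg i g x - g x) := fun x =>
    (sub_sub_sub_cancel_right _ _ _).symm
  rw [funext e'] at hsucc
  rw [e]
  refine tsum_energy_le (by positivity) (by positivity)
    (fun n x => shiftAvg n g x - g x)
    (hconst.powSum_shiftAvg_sub_le (by linarith) (pow_pos two_pos j) hi0)
    hsucc ?_
  obtain ⟨d, rfl⟩ := Nat.exists_eq_add_of_le hkj
  have hd : scaleDist (k + d) k = d := by unfold scaleDist; omega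
  rw [hd, min_eq_right (Nat.le_add_right k d)]
  push_cast
  set A : ℝ := 2 ^ k with hA
  have hA0 : 0 < A := by positivity
  have hiA : (i : ℝ)⁻¹ ≤ A⁻¹ := inv_anti₀ hA0 (by rw [hA]; exact_mod_cast hi)
  have hkd : (i : ℝ) / 2 ^ (k + d) ≤ 4 * (1 / 2) ^ d := by
    have h : (i : ℝ) ≤ 4 * A := by
      have h : (i : ℝ) < 2 ^ (k + 2) := by exact_mod_cast hi'
      rw [pow_add, ← hA] at h
      linarith
    rw [pow_add, ← hA, one_div, inv_pow, div_le_iff₀ (by positivity)]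
    field_simp
    linarith
  set T : ℝ := (1 / 2) ^ d
  have hT0 : 0 < T := by positivity
  have h1 : A⁻¹ * (2 ^ (p + 1) * ((i : ℝ) / 2 ^ (k + d))) ≤ 2 ^ (2 * p + 2) * 4 * (A⁻¹ * T) := by
    calc _ ≤ A⁻¹ * (2 ^ (2 * p + 2) * (4 * T)) := by
          gcongr
          · norm_num
          · linarith
          · norm_num
      _ = _ := by ring
  have h2 : A ^ (p - 1) * (2 ^ (2 * p + 2) * (i : ℝ)⁻¹ ^ p * ((i : ℝ) / 2 ^ (k + d)))
      ≤ 2 ^ (2 * p + 2) * 4 * (A⁻¹ * T) := by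
    calc _ ≤ A ^ (p - 1) * (2 ^ (2 * p + 2) * A⁻¹ ^ p * (4 * T)) := by
          gcongr
      _ = _ := by
          rw [Real.inv_rpow hA0.le, Real.rpow_sub_one hA0.ne']
          field_simp
  have e5 : (2 : ℝ) ^ (2 * p + 5) = 2 ^ (2 * p + 2) * 2 ^ (3 : ℝ) := by
    rw [← Real.rpow_add (by norm_num)]
    ring_nf
  have e4 : (2 : ℝ) ^ (3 : ℝ) = 8 := by norm_num
  rw [e5, e4]
  linarith

theorem tsum_energy_pieceError_le {p : ℝ} (hp : 2 ≤ p) {N k j i : ℕ} (hk : k < N) (hj : j ≤ N)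
    (hi : 2 ^ k ≤ i) (hi' : i < 2 ^ (k + 2)) (f : ℤ → B) :
    ∑' x, ENNReal.ofReal (energy p (2 ^ min j k) (fun n => pieceError N f k j n x) i)
      ≤ ENNReal.ofReal (2 ^ (2 * p + 5) * ((2 ^ k)⁻¹ * (1 / 2) ^ scaleDist j k))
        * powSum p (dyadicPiece N f j) := by
  rcases le_or_gt k j with h | h
  · exact tsum_energy_pieceError_le_of_ge hp hj h hi hi' f
  · exact tsum_energy_pieceError_le_of_lt hp hk h hi f

/-- The constant in the summed bound of the comparison error. -/
noncomputable def errorSumConst (p : ℝ) : ℝ := 3 * 2 ^ (2 * p + 5) * (2 * (1 - √2 / 2)⁻¹)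

theorem tsum_errorEnergy_le_sum {p : ℝ} (hp : 2 ≤ p) (N : ℕ) (f : ℤ → B) :
    ∑' x, ENNReal.ofReal (errorEnergy p N f x)
      ≤ ENNReal.ofReal (errorSumConst p) * ∑ j ∈ range (N + 1), powSum p (dyadicPiece N f j) := by
  set ρ : ℝ := √2 / 2 with hρ
  have hρ0 : 0 ≤ ρ := by positivity
  have hρ1 : ρ < 1 := by
    rw [hρ, div_lt_one (by norm_num)]
    exact Real.sqrt_lt' (by norm_num) |>.2 (by norm_num)
  have hexp : ∀ x, ENNReal.ofReal (errorEnergy p N f x)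
      = ∑ k ∈ range N, ∑ i ∈ Ico (2 ^ k) (2 ^ (k + 2)), ∑ j ∈ range (N + 1),
        ENNReal.ofReal (√2 ^ scaleDist j k) *
          ENNReal.ofReal (energy p (2 ^ min j k) (fun n => pieceError N f k j n x) i) := by
    intro x
    have h0 : ∀ k i j, 0 ≤ √2 ^ scaleDist j k *
        energy p (2 ^ min j k) (fun n => pieceError N f k j n x) i := fun k i j =>
      mul_nonneg (by positivity) (energy_nonneg _ _ _ _)
    rw [errorEnergy, ENNReal.ofReal_sum_of_nonneg fun k _ => sum_nonneg fun i _ =>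
      sum_nonneg fun j _ => h0 k i j]
    refine sum_congr rfl fun k _ => ?_
    rw [ENNReal.ofReal_sum_of_nonneg fun i _ => sum_nonneg fun j _ => h0 k i j]
    refine sum_congr rfl fun i _ => ?_
    rw [ENNReal.ofReal_sum_of_nonneg fun j _ => h0 k i j]
    exact sum_congr rfl fun j _ => ENNReal.ofReal_mul (by positivity)
  simp only [hexp]
  rw [Summable.tsum_finsetSum fun _ _ => ENNReal.summable]
  have hk : ∀ k ∈ range N, ∑' x, ∑ i ∈ Ico (2 ^ k) (2 ^ (k + 2)), ∑ j ∈ range (N + 1),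
        ENNReal.ofReal (√2 ^ scaleDist j k) *
          ENNReal.ofReal (energy p (2 ^ min j k) (fun n => pieceError N f k j n x) i)
      ≤ ∑ j ∈ range (N + 1), ENNReal.ofReal (3 * 2 ^ (2 * p + 5) * ρ ^ scaleDist j k)
          * powSum p (dyadicPiece N f j) := by
    intro k hk
    rw [Summable.tsum_finsetSum fun _ _ => ENNReal.summable]
    have hi : ∀ i ∈ Ico (2 ^ k) (2 ^ (k + 2)), ∑' x, ∑ j ∈ range (N + 1),
          ENNReal.ofReal (√2 ^ scaleDist j k) *
            ENNReal.ofReal (energy p (2 ^ min j k) (fun n => pieceError N f k j n x) i)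
        ≤ ∑ j ∈ range (N + 1),
            ENNReal.ofReal (2 ^ (2 * p + 5) * ((2 ^ k)⁻¹ * ρ ^ scaleDist j k))
              * powSum p (dyadicPiece N f j) := by
      intro i hi
      rw [mem_Ico] at hi
      rw [Summable.tsum_finsetSum fun _ _ => ENNReal.summable]
      refine sum_le_sum fun j hj => ?_
      rw [ENNReal.tsum_mul_left]
      refine (mul_le_mul_right (tsum_energy_pieceError_le hp (mem_range.1 hk)
        (Nat.lt_succ_iff.1 (mem_range.1 hj)) hi.1 hi.2 f) _).trans_eq ?_
      rw [← mul_assoc, ← ENNReal.ofReal_mul (by positivity)]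
      congr 2
      rw [hρ, div_eq_mul_one_div (√2) 2, mul_pow]
      ring
    refine (sum_le_sum hi).trans_eq ?_
    rw [sum_const, nsmul_eq_mul, mul_sum]
    refine sum_congr rfl fun j _ => ?_
    have hcard : #(Ico (2 ^ k) (2 ^ (k + 2))) = 3 * 2 ^ k := by
      rw [Nat.card_Ico, pow_add]
      omega
    rw [hcard, ← mul_assoc, ← ENNReal.ofReal_natCast, ← ENNReal.ofReal_mul (by positivity)]
    congr 2
    push_cast
    field_simp
  refine (sum_le_sum hk).trans ?_
  rw [sum_comm, mul_sum]
  refine sum_le_sum fun j _ => ?_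
  rw [← sum_mul]
  gcongr
  rw [← ENNReal.ofReal_sum_of_nonneg fun k _ => by positivity, ← mul_sum, errorSumConst]
  gcongr
  simp only [scaleDist_comm j]
  exact sum_pow_scaleDist_le hρ0 hρ1 j N

theorem sum_powSum_dyadicPiece_le {p δ : ℝ} (hB : UniformlyAboveTangents B p δ) (hδ : 0 < δ)
    (N : ℕ) (f : ℤ → B) :
    ∑ j ∈ range (N + 1), powSum p (dyadicPiece N f j)
      ≤ ENNReal.ofReal (1 + δ⁻¹) * powSum p f := by
  have h := tsum_anchor_le hB hδ 0 N f
  simp only [anchor_zero_eq] at h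
  rw [ENNReal.tsum_add, ENNReal.tsum_mul_left,
    Summable.tsum_finsetSum fun _ _ => ENNReal.summable] at h
  have e1 : powSum p (dyadicPiece N f N) = ∑' x, ENNReal.ofReal (‖dyadicAvg N f x‖ ^ p) := by
    rw [dyadicPiece, if_neg (lt_irrefl N), powSum]
  have e2 : ∑ j ∈ range N, powSum p (dyadicPiece N f j)
      = ∑ s ∈ range N, ∑' x,
        ENNReal.ofReal (‖dyadicPath N f x (s + 1) - dyadicPath N f x s‖ ^ p) := by
    rw [← sum_range_reflect]
    refine sum_congr rfl fun s hs => ?_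
    rw [mem_range] at hs
    rw [dyadicPiece, if_pos (by omega), powSum]
    refine tsum_congr fun x => ?_
    rw [dyadicPath, dyadicPath, show N - 1 - s = N - (s + 1) by omega,
      show N - (s + 1) + 1 = N - s by omega]
  rw [← e1, ← e2] at h
  have h1 : powSum p (dyadicPiece N f N) ≤ powSum p f := le_self_add.trans h
  have h2 : ∑ j ∈ range N, powSum p (dyadicPiece N f j) ≤ ENNReal.ofReal δ⁻¹ * powSum p f := by
    have := mul_le_mul_right (le_add_self.trans h) (ENNReal.ofReal δ⁻¹)
    rwa [← mul_assoc, ← ENNReal.ofReal_mul (by positivity), inv_mul_cancel₀ hδ.ne',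
      ENNReal.ofReal_one, one_mul] at this
  rw [sum_range_succ, ENNReal.ofReal_add zero_le_one (by positivity), ENNReal.ofReal_one, add_mul,
    one_mul, add_comm]
  exact add_le_add h1 h2

theorem tsum_errorEnergy_le {p δ : ℝ} (hp : 2 ≤ p) (hB : UniformlyAboveTangents B p δ)
    (hδ : 0 < δ) (N : ℕ) (f : ℤ → B) :
    ∑' x, ENNReal.ofReal (errorEnergy p N f x)
      ≤ ENNReal.ofReal (errorSumConst p) * (ENNReal.ofReal (1 + δ⁻¹) * powSum p f) :=
  (tsum_errorEnergy_le_sum hp N f).trans (mul_le_mul_right (sum_powSum_dyadicPiece_le hB hδ N f) _)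

end ErrorSum

/-! ### The variational inequality -/

theorem sum_rpow_le_rpow_sum {ι : Type*} {r : ℝ} (hr : 1 ≤ r) (s : Finset ι) (y : ι → ℝ≥0∞) :
    ∑ i ∈ s, y i ^ r ≤ (∑ i ∈ s, y i) ^ r := by
  classical
  induction s using Finset.induction_on with
  | empty => simp
  | insert a s ha ih =>
    rw [sum_insert ha, sum_insert ha]
    exact (add_le_add_right ih _).trans (ENNReal.add_rpow_le_rpow_add _ _ hr)

theorem rpow_one_sub_mul_rpow_le_add {θ : ℝ} (h0 : 0 ≤ θ) (h1 : θ ≤ 1) (u v : ℝ≥0∞) :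
    u ^ (1 - θ) * v ^ θ ≤ u + v := by
  calc u ^ (1 - θ) * v ^ θ ≤ (u + v) ^ (1 - θ) * (u + v) ^ θ :=
        mul_le_mul' (ENNReal.rpow_le_rpow le_self_add (by linarith))
          (ENNReal.rpow_le_rpow le_add_self h0)
    _ = u + v := by
        rw [← ENNReal.rpow_add_of_nonneg _ _ (by linarith) h0, sub_add_cancel, ENNReal.rpow_one]

theorem nnnorm_rpow_eq_ofReal {B : Type*} [NormedAddCommGroup B] {q : ℝ} (hq : 0 ≤ q) (v : B) :
    (‖v‖₊ : ℝ≥0∞) ^ q = ENNReal.ofReal (‖v‖ ^ q) := by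
  rw [← ENNReal.ofReal_rpow_of_nonneg (norm_nonneg v) hq, ofReal_norm, enorm_eq_nnnorm]

theorem tsum_iSup_le {ι : Type*} {F : ι → ℕ → ℝ≥0∞} (hF : ∀ x, Monotone (F x)) {D : ℝ≥0∞}
    (h : ∀ N, ∑' x, F x N ≤ D) : ∑' x, ⨆ N, F x N ≤ D := by
  rw [ENNReal.tsum_eq_iSup_sum]
  refine iSup_le fun s => ?_
  rw [ENNReal.finsetSum_iSup_of_monotone hF]
  exact iSup_le fun N => (ENNReal.sum_le_tsum s).trans (h N)

section Variation

variable {B : Type*} [NormedAddCommGroup B] [NormedSpace ℝ B]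

/-- The `q`-variation (without the root) of the averages of length less than `2 ^ N`. -/
noncomputable def variationUpTo (q : ℝ) (f : ℤ → B) (x : ℤ) (N : ℕ) : ℝ≥0∞ :=
  ⨆ (m : ℕ) (t : ℕ → ℕ) (_ : StrictMono t) (_ : 0 < t 0) (_ : t m < 2 ^ N),
    ∑ k ∈ range m, (‖shiftAvg (t (k + 1)) f x - shiftAvg (t k) f x‖₊ : ℝ≥0∞) ^ q

theorem variationUpTo_mono (q : ℝ) (f : ℤ → B) (x : ℤ) : Monotone (variationUpTo q f x) := by
  intro N N' hN
  refine iSup_le fun m => iSup_le fun t => iSup_le fun ht => iSup_le fun ht0 => iSup_le fun hm => ?_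
  exact le_iSup₂_of_le m t (le_iSup₂_of_le ht ht0
    (le_iSup_of_le (hm.trans_le (Nat.pow_le_pow_right two_pos hN)) le_rfl))

theorem variation_le_iSup_variationUpTo (q : ℝ) (f : ℤ → B) (x : ℤ) :
    ⨆ (m : ℕ) (t : ℕ → ℕ) (_ : StrictMono t) (_ : 0 < t 0),
      ∑ k ∈ range m, (‖shiftAvg (t (k + 1)) f x - shiftAvg (t k) f x‖₊ : ℝ≥0∞) ^ q
      ≤ ⨆ N, variationUpTo q f x N := by
  refine iSup_le fun m => iSup_le fun t => iSup_le fun ht => iSup_le fun ht0 => ?_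
  refine le_iSup_of_le (t m) ?_
  exact le_iSup₂_of_le m t (le_iSup₂_of_le ht ht0 (le_iSup_of_le Nat.lt_two_pow_self le_rfl))

theorem variationUpTo_le {p q : ℝ} (hp : 2 ≤ p) (hpq : p < q) (f : ℤ → B) (x : ℤ) (N : ℕ) :
    variationUpTo q f x N ≤ ENNReal.ofReal (2 ^ q) *
      (ENNReal.ofReal (errorConst p * (1 + 2 ^ (p + 1)) * errorEnergy p N f x) ^ (q / p)
        + ENNReal.ofReal (4 ^ q * 2 ^ p * runMax (dyadicPath N f x) N ^ (q - p))
          * anchorSum p q (dyadicPath N f x) N) := by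
  refine iSup_le fun m => iSup_le fun t => iSup_le fun ht => iSup_le fun ht0 => iSup_le fun hm => ?_
  have hp0 : 0 < p := by linarith
  have hq0 : 0 < q := by linarith
  set b : ℕ → B := fun i => dyadicAvg (Nat.log 2 (t i)) f x with hb
  set c : ℕ → B := fun i => shiftAvg (t i) f x - b i with hc
  have hterm : ∀ k ∈ range m, (‖shiftAvg (t (k + 1)) f x - shiftAvg (t k) f x‖₊ : ℝ≥0∞) ^ q
      ≤ ENNReal.ofReal (2 ^ q) *
        (ENNReal.ofReal (‖c (k + 1) - c k‖ ^ q) + ENNReal.ofReal (‖b k - b (k + 1)‖ ^ q)) := by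
    intro k _
    rw [nnnorm_rpow_eq_ofReal hq0.le, ← ENNReal.ofReal_add (by positivity) (by positivity),
      ← ENNReal.ofReal_mul (by positivity)]
    refine ENNReal.ofReal_le_ofReal ?_
    have e : shiftAvg (t (k + 1)) f x - shiftAvg (t k) f x
        = (c (k + 1) - c k) - (b k - b (k + 1)) := by
      simp only [hc]
      abel
    rw [e]
    exact (Real.rpow_le_rpow (norm_nonneg _) (norm_sub_le _ _) hq0.le).trans
      (add_rpow_le_two_rpow_mul hq0.le (norm_nonneg _) (norm_nonneg _))
  refine (sum_le_sum hterm).trans ?_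
  rw [← mul_sum, sum_add_distrib]
  gcongr ENNReal.ofReal (2 ^ q) * (?_ + ?_)
  · have e : ∀ k, ENNReal.ofReal (‖c (k + 1) - c k‖ ^ q)
        = ENNReal.ofReal (‖c (k + 1) - c k‖ ^ p) ^ (q / p) := by
      intro k
      rw [ENNReal.ofReal_rpow_of_nonneg (by positivity) (by positivity),
        ← Real.rpow_mul (norm_nonneg _), mul_div_cancel₀ _ hp0.ne']
    simp only [e]
    refine (sum_rpow_le_rpow_sum ((one_le_div hp0).2 hpq.le) _ _).trans ?_
    refine ENNReal.rpow_le_rpow ?_ (by positivity)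
    rw [← ENNReal.ofReal_sum_of_nonneg fun k _ => by positivity]
    exact ENNReal.ofReal_le_ofReal
      (sum_norm_error_rpow_le (by linarith) f x ht.monotone ht0 hm)
  · have hlog : ∀ i ≤ m, Nat.log 2 (t i) ≤ N := fun i hi =>
      (Nat.log_lt_of_lt_pow (ht0.trans_le (ht.monotone (Nat.zero_le i))).ne'
        ((ht.monotone hi).trans_lt hm)).le
    have hb' : ∀ i ≤ m, b i = dyadicPath N f x (N - Nat.log 2 (t i)) := by
      intro i hi
      rw [dyadicPath, Nat.sub_sub_self (hlog i hi)]
    refine le_of_eq_of_le (sum_congr rfl fun i hi => ?_)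
      (sum_norm_sub_rpow_le_anchorSum hp0.le hq0 hpq.le (dyadicPath N f x)
        (τ := fun i => N - Nat.log 2 (t i)) (fun i j hij => ?_) (Nat.sub_le _ _) m)
    · have hi' := mem_range.1 hi
      rw [hb' i hi'.le, hb' (i + 1) hi']
    · exact Nat.sub_le_sub_left (Nat.log_mono_right (ht.monotone hij)) N

theorem variationUpTo_rpow_le {p q : ℝ} (hp : 2 ≤ p) (hpq : p < q) (f : ℤ → B) (x : ℤ) (N : ℕ) :
    variationUpTo q f x N ^ (p / q) ≤ ENNReal.ofReal (2 ^ q) ^ (p / q) *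
      (ENNReal.ofReal (errorConst p * (1 + 2 ^ (p + 1))) * ENNReal.ofReal (errorEnergy p N f x)
        + ENNReal.ofReal (4 ^ q * 2 ^ p) ^ (p / q) *
          (ENNReal.ofReal (runMax (dyadicPath N f x) N ^ p)
            + anchorSum p q (dyadicPath N f x) N)) := by
  have hp0 : 0 < p := by linarith
  have hq0 : 0 < q := by linarith
  have hθ0 : 0 ≤ p / q := by positivity
  have hθ1 : p / q ≤ 1 := (div_le_one hq0).2 hpq.le
  refine (ENNReal.rpow_le_rpow (variationUpTo_le hp hpq f x N) hθ0).trans ?_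
  rw [ENNReal.mul_rpow_of_nonneg _ _ hθ0]
  gcongr ENNReal.ofReal (2 ^ q) ^ (p / q) * ?_
  refine (ENNReal.rpow_add_le_add_rpow _ _ hθ0 hθ1).trans (add_le_add (le_of_eq ?_) ?_)
  · rw [← ENNReal.rpow_mul, div_mul_div_cancel₀ hp0.ne', div_self hq0.ne', ENNReal.rpow_one,
      ENNReal.ofReal_mul (mul_nonneg (errorConst_nonneg (by linarith)) (by positivity))]
  · have hR := runMax_nonneg (dyadicPath N f x) N
    set R := runMax (dyadicPath N f x) N
    rw [ENNReal.ofReal_mul (by positivity), mul_assoc, ENNReal.mul_rpow_of_nonneg _ _ hθ0,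
      ENNReal.mul_rpow_of_nonneg _ _ hθ0]
    gcongr ENNReal.ofReal (4 ^ q * 2 ^ p) ^ (p / q) * ?_
    have e : ENNReal.ofReal (R ^ (q - p)) ^ (p / q) = ENNReal.ofReal (R ^ p) ^ (1 - p / q) := by
      rw [ENNReal.ofReal_rpow_of_nonneg (Real.rpow_nonneg hR _) hθ0,
        ENNReal.ofReal_rpow_of_nonneg (Real.rpow_nonneg hR _) (by linarith),
        ← Real.rpow_mul hR, ← Real.rpow_mul hR]
      congr 2
      field_simp
    rw [e]
    exact rpow_one_sub_mul_rpow_le_add hθ0 hθ1 _ _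

/-- The constant in the variational inequality. -/
noncomputable def variationConst (p q δ : ℝ) : ℝ≥0∞ :=
  ENNReal.ofReal (2 ^ q) ^ (p / q) *
    (ENNReal.ofReal (errorConst p * (1 + 2 ^ (p + 1))) *
        (ENNReal.ofReal (errorSumConst p) * ENNReal.ofReal (1 + δ⁻¹))
      + ENNReal.ofReal (4 ^ q * 2 ^ p) ^ (p / q) *
        (ENNReal.ofReal (4 ^ p)
          + (∑' m : ℕ, ENNReal.ofReal (((1 / 2 : ℝ) ^ (m + 1)) ^ (q - p))) * ENNReal.ofReal δ⁻¹))

theorem variationConst_ne_top {p q : ℝ} (hp : 0 ≤ p) (hpq : p < q) (δ : ℝ) :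
    variationConst p q δ ≠ ⊤ := by
  have hθ : 0 ≤ p / q := div_nonneg hp (by linarith)
  have h := tsum_scale_weight_ne_top (sub_pos.2 hpq)
  have hpow : ∀ a : ℝ, ENNReal.ofReal a ^ (p / q) ≠ ⊤ := fun a =>
    ENNReal.rpow_ne_top_of_nonneg hθ ENNReal.ofReal_ne_top
  unfold variationConst
  refine ENNReal.mul_ne_top (hpow _) (ENNReal.add_ne_top.2 ⟨?_, ?_⟩)
  · exact ENNReal.mul_ne_top ENNReal.ofReal_ne_top
      (ENNReal.mul_ne_top ENNReal.ofReal_ne_top ENNReal.ofReal_ne_top)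
  · exact ENNReal.mul_ne_top (hpow _) (ENNReal.add_ne_top.2
      ⟨ENNReal.ofReal_ne_top, ENNReal.mul_ne_top h ENNReal.ofReal_ne_top⟩)

theorem tsum_variationUpTo_rpow_le {p q δ : ℝ} (hp : 2 ≤ p) (hpq : p < q)
    (hB : UniformlyAboveTangents B p δ) (hδ : 0 < δ) (f : ℤ → B) (N : ℕ) :
    ∑' x, variationUpTo q f x N ^ (p / q) ≤ variationConst p q δ * powSum p f := by
  refine (ENNReal.tsum_le_tsum fun x => variationUpTo_rpow_le hp hpq f x N).trans ?_
  rw [ENNReal.tsum_mul_left, ENNReal.tsum_add, ENNReal.tsum_mul_left, ENNReal.tsum_mul_left,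
    ENNReal.tsum_add]
  have h1 := tsum_errorEnergy_le hp hB hδ N f
  have h2 := tsum_runMax_rpow_le hp N f
  have h3 := tsum_anchorSum_le (q := q) hB hδ N f
  rw [← powSum] at h2 h3
  rw [variationConst, mul_assoc, add_mul, mul_assoc (ENNReal.ofReal (errorConst p * _)),
    mul_assoc (ENNReal.ofReal (errorSumConst p)), mul_assoc (ENNReal.ofReal (4 ^ q * 2 ^ p) ^ _),
    add_mul, mul_assoc (∑' m : ℕ, _)]
  gcongr

/-- The variational inequality in a space whose norm is uniformly above its tangents. -/
theorem tsum_variation_rpow_le {p q δ : ℝ} (hp : 2 ≤ p) (hpq : p < q)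
    (hB : UniformlyAboveTangents B p δ) (hδ : 0 < δ) (f : ℤ → B) :
    ∑' x : ℤ, (⨆ (m : ℕ) (t : ℕ → ℕ) (_ : StrictMono t) (_ : 0 < t 0),
        ∑ k ∈ range m, (‖shiftAvg (t (k + 1)) f x - shiftAvg (t k) f x‖₊ : ℝ≥0∞) ^ q) ^ (p / q)
      ≤ variationConst p q δ * powSum p f := by
  have hθ : 0 < p / q := div_pos (by linarith) (by linarith)
  have hsup : ∀ x, (⨆ N, variationUpTo q f x N) ^ (p / q)
      = ⨆ N, variationUpTo q f x N ^ (p / q) := fun x =>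
    (ENNReal.orderIsoRpow (p / q) hθ).map_iSup _
  refine (ENNReal.tsum_le_tsum fun x =>
    ENNReal.rpow_le_rpow (variation_le_iSup_variationUpTo q f x) hθ.le).trans ?_
  simp only [hsup]
  exact tsum_iSup_le
    (fun x N N' hN => ENNReal.rpow_le_rpow (variationUpTo_mono q f x hN) hθ.le)
    (tsum_variationUpTo_rpow_le hp hpq hB hδ f)

end Variation

/-- For `q > p ≥ 2` and `K > 0` there is `C > 0` depending only on `p`, `q` and `K` such that
for every real Banach space `B` with modulus of uniform convexity `η(ε) = K ε^p` and every
`f ∈ ℓ^p(B)`, `∑_{x ∈ ℤ} V(x)^{p/q} ≤ C^p ‖f‖_{ℓ^p(B)}^p`, where `V x` is the supremum over all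
finite strictly increasing sequences `t 0 < t 1 < … < t m` of positive integers of
`∑_{k<m} ‖(A_{t(k+1)} f)(x) − (A_{t k} f)(x)‖^q` (in `ℝ≥0∞`). -/
theorem stmt10 (p q K : ℝ) (hp : 2 ≤ p) (hpq : p < q) (hK : 0 < K) :
    ∃ C : ℝ, 0 < C ∧
      ∀ (B : Type*) [NormedAddCommGroup B] [NormedSpace ℝ B] [CompleteSpace B],
        (∀ ε ∈ Set.Ioc (0 : ℝ) 2, ∀ x y : B, ‖x‖ ≤ 1 → ‖y‖ ≤ 1 → ε ≤ ‖x - y‖ →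
          ‖(1 / 2 : ℝ) • (x + y)‖ ≤ 1 - K * ε ^ p) →
        ∀ f : ℤ → B, Memℓp f (ENNReal.ofReal p) →
          ∑' x : ℤ,
              (⨆ (m : ℕ) (t : ℕ → ℕ) (_ : StrictMono t) (_ : 0 < t 0),
                ∑ k ∈ Finset.range m,
                  (‖shiftAvg (t (k + 1)) f x - shiftAvg (t k) f x‖₊ : ℝ≥0∞) ^ q) ^ (p / q)
            ≤ ENNReal.ofReal C ^ p * ∑' x : ℤ, (‖f x‖₊ : ℝ≥0∞) ^ p := by
  have hp0 : 0 < p := by linarith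
  set c := variationConst p q (2 * twoPointConst p K) with hc
  have hctop : c ≠ ⊤ := variationConst_ne_top hp0.le hpq _
  have hc0 : 0 < c.toReal + 1 := by positivity
  refine ⟨(c.toReal + 1) ^ p⁻¹, by positivity, fun B _ _ _ hB f _ => ?_⟩
  have hC : c ≤ ENNReal.ofReal ((c.toReal + 1) ^ p⁻¹) ^ p := by
    rw [ENNReal.ofReal_rpow_of_nonneg (by positivity) hp0.le, ← Real.rpow_mul hc0.le,
      inv_mul_cancel₀ hp0.ne', Real.rpow_one, ENNReal.le_ofReal_iff_toReal_le hctop hc0.le]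
    linarith
  simp only [nnnorm_rpow_eq_ofReal hp0.le]
  have hδ : 0 < 2 * twoPointConst p K := mul_pos two_pos (twoPointConst_pos hK)
  exact (tsum_variation_rpow_le hp hpq (uniformlyAboveTangents hp hK hB) hδ f).trans
    (mul_le_mul_left hC _)
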